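/- arXiv:2501.07466 — 6 statements merged into one kernel-verified Lean document; each statement's English description precedes it below -/
import Mathlib

section
/- The set Σ = {m∈(0,∞) : ∂_ξ³θ(ξ;m)|_{ξ=0} = 0} is discrete in (0,∞): it has no accumulation point in (0,∞), i.e. every m∈(0,∞) has an open neighborhood whose intersection with Σ contains at most one point. -/
noncomputable section

/-- The dispersion relation θ(ξ; m). -/
def theta (m ξ : ℝ) : ℝ :=
  Real.arctan (ξ * Real.sin (Real.sqrt (m ^ 2 + ξ ^ 2)) /
    Real.sqrt (m ^ 2 + ξ ^ 2 * Real.cos (Real.sqrt (m ^ 2 + ξ ^ 2)) ^ 2))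

/-- The exceptional mass set Σ. -/
def SigmaSet : Set ℝ := {m | 0 < m ∧ iteratedDeriv 3 (theta m) 0 = 0}

open Filter Topology

lemma tendsto_sq_nhds_zero : Tendsto (fun x : ℝ => x ^ 2) (𝓝 0) (𝓝 0) := by
  simpa using (continuous_pow (M := ℝ) 2).tendsto 0

/-- The third derivative at the origin of a function whose derivative is `x ↦ K (x ^ 2)`. -/
lemma iteratedDeriv_three_of_deriv_eq_comp_sq {f K : ℝ → ℝ} (hK : ContDiffAt ℝ 1 K 0)
    (hf : deriv f =ᶠ[𝓝 0] fun x => K (x ^ 2)) :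
    iteratedDeriv 3 f 0 = 2 * deriv K 0 := by
  have hdiff : ∀ᶠ x : ℝ in 𝓝 0, DifferentiableAt ℝ K (x ^ 2) := by
    refine tendsto_sq_nhds_zero.eventually ?_
    filter_upwards [hK.eventually (by simp)] with x hx using hx.differentiableAt (by simp)
  have hsecond : deriv (deriv f) =ᶠ[𝓝 0] fun x => x * (2 * deriv K (x ^ 2)) := by
    refine hf.deriv.trans ?_
    filter_upwards [hdiff] with x hx
    have := (hx.hasDerivAt.comp (h := fun y : ℝ => y ^ 2) x (hasDerivAt_pow 2 x)).deriv
    simp only [Function.comp_def] at this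
    rw [this]
    push_cast
    ring
  have hcont : ContinuousAt (fun x : ℝ => 2 * deriv K (x ^ 2)) 0 := by
    have hd : ContinuousAt (deriv K) 0 := (hK.derivWithin (m := 0) (by simp)).continuousAt
    refine continuousAt_const.mul (ContinuousAt.comp (g := deriv K) (f := fun x : ℝ => x ^ 2) ?_ ?_)
    · simpa using hd
    · fun_prop
  have hthird : HasDerivAt (fun x => x * (2 * deriv K (x ^ 2))) (2 * deriv K 0) 0 := by
    rw [hasDerivAt_iff_tendsto_slope]
    have h := hcont.tendsto.mono_left (nhdsWithin_le_nhds (s := {0}ᶜ))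
    simp only [ne_eq, OfNat.ofNat_ne_zero, not_false_eq_true, zero_pow] at h
    refine h.congr' ?_
    filter_upwards [self_mem_nhdsWithin] with x hx
    have : x ≠ 0 := hx
    simp [slope_def_field, this]
  rw [iteratedDeriv_succ, iteratedDeriv_succ, iteratedDeriv_one, hsecond.deriv_eq, hthird.deriv]

lemma iteratedDeriv_three_arctan_mul_comp_sq {G : ℝ → ℝ} (hG : ContDiffAt ℝ 2 G 0) :
    iteratedDeriv 3 (fun x => Real.arctan (x * G (x ^ 2))) 0 =
      2 * (3 * deriv G 0 - G 0 ^ 3) := by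
  have hdG : ContDiffAt ℝ 1 (deriv G) 0 :=
    hG.derivWithin (by norm_num)
  have hG1 : ContDiffAt ℝ 1 G 0 := hG.of_le (by norm_num)
  set K : ℝ → ℝ := fun u => (G u + 2 * u * deriv G u) / (1 + u * G u ^ 2) with hKdef
  have hK : ContDiffAt ℝ 1 K 0 := by
    refine ContDiffAt.div ?_ ?_ (by simp)
    · fun_prop
    · fun_prop
  have hdiff : ∀ᶠ x : ℝ in 𝓝 0, DifferentiableAt ℝ G (x ^ 2) := by
    refine tendsto_sq_nhds_zero.eventually ?_
    filter_upwards [hG1.eventually (by simp)] with x hx using hx.differentiableAt (by simp)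
  rw [iteratedDeriv_three_of_deriv_eq_comp_sq hK]
  · have h0 := (hG1.differentiableAt (by simp)).hasDerivAt
    have h1 := (hdG.differentiableAt (by simp)).hasDerivAt
    have h := ((h0.add (((hasDerivAt_id (0 : ℝ)).const_mul 2).mul h1)).div
      (((hasDerivAt_id (0 : ℝ)).mul (h0.pow 2)).const_add 1) (by simp)).deriv
    have hK' : deriv K 0 = _ := h
    rw [hK']
    simp
    ring
  · filter_upwards [hdiff] with x hx
    have h := (((hasDerivAt_id x).mul (hx.hasDerivAt.comp (h := fun y : ℝ => y ^ 2) x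
      (hasDerivAt_pow 2 x))).arctan).deriv
    have h' : deriv (fun x => Real.arctan (x * G (x ^ 2))) x = _ := h
    rw [h', hKdef]
    have : 1 + x ^ 2 * G (x ^ 2) ^ 2 ≠ 0 := by positivity
    simp [mul_pow]
    field_simp

lemma iteratedDeriv_three_theta {m : ℝ} (hm : 0 < m) :
    iteratedDeriv 3 (theta m) 0 =
      (3 * m * Real.cos m - 3 * Real.sin m + Real.sin m ^ 3) / m ^ 3 := by
  set w : ℝ → ℝ := fun u => Real.sqrt (m ^ 2 + u) with hw
  set G : ℝ → ℝ := fun u =>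
    Real.sin (w u) / Real.sqrt (m ^ 2 + u * Real.cos (w u) ^ 2) with hGdef
  have hw0 : w 0 = m := by simp [hw, hm.le]
  have hwc : ContDiffAt ℝ 2 w 0 := by
    refine ContDiffAt.sqrt (by fun_prop) (by simp [hm.ne'])
  have hG : ContDiffAt ℝ 2 G 0 := by
    refine ContDiffAt.div (Real.contDiff_sin.contDiffAt.comp 0 hwc)
      (ContDiffAt.sqrt ?_ (by simp [hm.ne'])) ?_
    · have := Real.contDiff_cos.contDiffAt.comp (n := 2) 0 hwc
      exact contDiffAt_const.add (contDiffAt_id.mul (this.pow 2))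
    · simp [hm.ne', Real.sqrt_sq hm.le]
  have htheta : theta m = fun x => Real.arctan (x * G (x ^ 2)) := by
    ext x
    simp only [theta, hGdef, hw, mul_div_assoc]
  have hG0 : G 0 = Real.sin m / m := by
    simp [hGdef, hw0, Real.sqrt_sq hm.le]
  have hwd : HasDerivAt w (1 / (2 * m)) 0 := by
    have := ((hasDerivAt_id (0 : ℝ)).const_add (m ^ 2)).sqrt (by simp [hm.ne'])
    simpa [Real.sqrt_sq hm.le] using this
  have hdG : deriv G 0 = Real.cos m / (2 * m ^ 2) - Real.sin m * Real.cos m ^ 2 / (2 * m ^ 3) := by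
    have h := (hwd.sin.div ((((hasDerivAt_id (0 : ℝ)).mul (hwd.cos.pow 2)).const_add
      (m ^ 2)).sqrt (by simp [hm.ne'])) (by simp [hm.ne', Real.sqrt_sq hm.le])).deriv
    have hG' : deriv G 0 = _ := h
    rw [hG']
    simp [hw0, Real.sqrt_sq hm.le]
    field_simp
  rw [htheta, iteratedDeriv_three_arctan_mul_comp_sq hG, hG0, hdG]
  field_simp
  linear_combination -3 * Real.sin m * Real.sin_sq_add_cos_sq m

theorem SigmaSet_discrete :
    ∀ m : ℝ, 0 < m → ∃ U : Set ℝ, IsOpen U ∧ m ∈ U ∧ (U ∩ SigmaSet).Subsingleton := by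
  intro m hm
  set F : ℝ → ℝ := fun x => 3 * x * Real.cos x - 3 * Real.sin x + Real.sin x ^ 3 with hF
  have hFan : AnalyticOnNhd ℝ F Set.univ := by
    intro x _
    have hs := Real.analyticAt_sin (x := x)
    have hc := Real.analyticAt_cos (x := x)
    fun_prop
  have hne : ∀ᶠ x in 𝓝[≠] m, F x ≠ 0 := by
    refine (hFan m trivial).eventually_eq_zero_or_eventually_ne_zero.resolve_left fun h => ?_
    have := hFan.eq_of_eventuallyEq analyticOnNhd_const (g := fun _ => (0 : ℝ)) h
    have hpi := congrFun this Real.pi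
    simp [hF, Real.pi_ne_zero] at hpi
  obtain ⟨U, hU, hmU, hUsub⟩ := eventually_nhds_iff.mp (eventually_nhdsWithin_iff.mp hne) |>.imp
    fun U h => (⟨h.2.1, h.2.2, h.1⟩ : IsOpen U ∧ m ∈ U ∧ ∀ x ∈ U, x ∈ ({m}ᶜ : Set ℝ) → F x ≠ 0)
  refine ⟨U, hU, hmU, ?_⟩
  have key : ∀ x ∈ U ∩ SigmaSet, x = m := by
    rintro x ⟨hxU, hx, hx3⟩
    by_contra hxm
    rw [iteratedDeriv_three_theta hx, div_eq_zero_iff] at hx3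
    exact hUsub x hxU hxm (hx3.resolve_right (by positivity))
  exact fun x hx y hy => (key x hx).trans (key y hy).symm

end
end

section
/- There exist C>0 and M>0 such that for every m∈Σ with m≥M one has ∂_ξ⁵θ(ξ;m)|_{ξ=0} ≠ 0 and | |m³·∂_ξ⁵θ(ξ;m)|_{ξ=0}| − 15 | ≤ C·m^{−2}. In particular, m³·∂_ξ⁵θ(0;m) = ±15 + O(m^{−2}) along Σ, with alternating sign. -/
noncomputable section

/-- If each function in a sequence is the derivative of the previous one, the sequence consists of
the iterated derivatives of its first term. -/
theorem iteratedDeriv_eq_of_hasDerivAt {F : ℕ → ℝ → ℝ} {n : ℕ}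
    (h : ∀ k < n, ∀ x, HasDerivAt (F k) (F (k + 1) x) x) : iteratedDeriv n (F 0) = F n := by
  induction n with
  | zero => exact iteratedDeriv_zero
  | succ n ih =>
    rw [iteratedDeriv_succ, ih fun k hk => h k (hk.trans n.lt_succ_self)]
    exact funext fun x => (h n n.lt_succ_self x).deriv

theorem ContDiff.hasDerivAt_iteratedDeriv {a : ℝ → ℝ} {n : ℕ} (ha : ContDiff ℝ n a) {k : ℕ}
    (hk : k < n) (x : ℝ) :
    HasDerivAt (iteratedDeriv k a) (iteratedDeriv (k + 1) a x) x := by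
  rw [iteratedDeriv_succ]
  exact (ha.differentiable_iteratedDeriv k (by exact_mod_cast hk) x).hasDerivAt

/-- The first derivatives at a zero of `a` of the function `sin ∘ a`. -/
theorem iteratedDeriv_sin_comp {a : ℝ → ℝ} (ha : ContDiff ℝ 5 a) {x : ℝ} (hx : a x = 0) :
    iteratedDeriv 1 (fun y => Real.sin (a y)) x = iteratedDeriv 1 a x ∧
    iteratedDeriv 2 (fun y => Real.sin (a y)) x = iteratedDeriv 2 a x ∧
    iteratedDeriv 3 (fun y => Real.sin (a y)) x =
      iteratedDeriv 3 a x - iteratedDeriv 1 a x ^ 3 ∧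
    iteratedDeriv 5 (fun y => Real.sin (a y)) x =
      iteratedDeriv 5 a x + iteratedDeriv 1 a x ^ 5
        - 15 * iteratedDeriv 1 a x * iteratedDeriv 2 a x ^ 2
        - 10 * iteratedDeriv 1 a x ^ 2 * iteratedDeriv 3 a x := by
  let A : ℕ → ℝ → ℝ := fun k => iteratedDeriv k a
  have hA : ∀ k < 5, ∀ y, HasDerivAt (A k) (A (k + 1) y) y := fun k hk y =>
    ContDiff.hasDerivAt_iteratedDeriv (n := 5) ha hk y
  have hA0 : A 0 = a := iteratedDeriv_zero
  let F : ℕ → ℝ → ℝ := fun k y => match k with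
    | 0 => Real.sin (A 0 y)
    | 1 => Real.cos (A 0 y) * A 1 y
    | 2 => -Real.sin (A 0 y) * A 1 y ^ 2 + Real.cos (A 0 y) * A 2 y
    | 3 => -Real.cos (A 0 y) * A 1 y ^ 3 - 3 * Real.sin (A 0 y) * A 1 y * A 2 y
        + Real.cos (A 0 y) * A 3 y
    | 4 => Real.sin (A 0 y) * A 1 y ^ 4 - 6 * Real.cos (A 0 y) * A 1 y ^ 2 * A 2 y
        - Real.sin (A 0 y) * (3 * A 2 y ^ 2 + 4 * A 1 y * A 3 y) + Real.cos (A 0 y) * A 4 y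
    | _ => Real.cos (A 0 y) * A 1 y ^ 5 + 10 * Real.sin (A 0 y) * A 1 y ^ 3 * A 2 y
        - Real.cos (A 0 y) * (15 * A 1 y * A 2 y ^ 2 + 10 * A 1 y ^ 2 * A 3 y)
        - Real.sin (A 0 y) * (10 * A 2 y * A 3 y + 5 * A 1 y * A 4 y) + Real.cos (A 0 y) * A 5 y
  have hF : ∀ k < 5, ∀ y, HasDerivAt (F k) (F (k + 1) y) y := by
    intro k hk y
    have h0 := hA 0 (by norm_num) y
    have h1 := hA 1 (by norm_num) y
    have h2 := hA 2 (by norm_num) y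
    have h3 := hA 3 (by norm_num) y
    have h4 := hA 4 (by norm_num) y
    have hs := h0.sin
    have hc := h0.cos
    interval_cases k
    · exact hs
    · refine (hc.mul h1).congr_deriv ?_
      simp only [F]; ring
    · refine ((hs.neg.mul (h1.pow 2)).add (hc.mul h2)).congr_deriv ?_
      simp only [F, Pi.neg_apply, Pi.pow_apply]; push_cast; ring
    · refine (((hc.neg.mul (h1.pow 3)).sub (((hs.const_mul 3).mul h1).mul h2)).add
        (hc.mul h3)).congr_deriv ?_
      simp only [F, Pi.neg_apply, Pi.pow_apply, Pi.mul_apply]; push_cast; ring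
    · refine ((((hs.mul (h1.pow 4)).sub (((hc.const_mul 6).mul (h1.pow 2)).mul h2)).sub
        (hs.mul (((h2.pow 2).const_mul 3).add ((h1.const_mul 4).mul h3)))).add
        (hc.mul h4)).congr_deriv ?_
      simp only [F, Pi.add_apply, Pi.pow_apply, Pi.mul_apply]; push_cast; ring
  have key : ∀ n ≤ 5, iteratedDeriv n (fun y => Real.sin (a y)) x = F n x := by
    intro n hn
    rw [← iteratedDeriv_eq_of_hasDerivAt fun k hk => hF k (hk.trans_le hn)]
    simp only [F, hA0]
  refine ⟨?_, ?_, ?_, ?_⟩ <;> rw [key _ (by norm_num)] <;> simp [F, hA0, hx, A] <;> ring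

/-- The functions `w ↦ (w⁻¹ d/dw) ^ k (sin w / w)` for `k ≤ 4`. -/
def sincDeriv (k : ℕ) (w : ℝ) : ℝ := match k with
  | 0 => Real.sin w / w
  | 1 => Real.cos w / w ^ 2 - Real.sin w / w ^ 3
  | 2 => -Real.sin w / w ^ 3 - 3 * Real.cos w / w ^ 4 + 3 * Real.sin w / w ^ 5
  | 3 => -Real.cos w / w ^ 4 + 6 * Real.sin w / w ^ 5 + 15 * Real.cos w / w ^ 6
      - 15 * Real.sin w / w ^ 7
  | _ => Real.sin w / w ^ 5 + 10 * Real.cos w / w ^ 6 - 45 * Real.sin w / w ^ 7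
      - 105 * Real.cos w / w ^ 8 + 105 * Real.sin w / w ^ 9

theorem hasDerivAt_sincDeriv {k : ℕ} (hk : k < 4) {w : ℝ} (hw : w ≠ 0) :
    HasDerivAt (sincDeriv k) (w * sincDeriv (k + 1) w) w := by
  have hs := Real.hasDerivAt_sin w
  have hc := Real.hasDerivAt_cos w
  have hp : ∀ n : ℕ, HasDerivAt (fun y : ℝ => y ^ n) (n * w ^ (n - 1)) w := fun n => hasDerivAt_pow n w
  have hn : ∀ n : ℕ, w ^ n ≠ 0 := fun n => pow_ne_zero n hw
  interval_cases k
  · refine (hs.div (hasDerivAt_id w) hw).congr_deriv ?_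
    simp only [sincDeriv, id]; field_simp
  · refine ((hc.div (hp 2) (hn 2)).sub (hs.div (hp 3) (hn 3))).congr_deriv ?_
    simp only [sincDeriv]; push_cast; field_simp; ring
  · refine (((hs.neg.div (hp 3) (hn 3)).sub ((hc.const_mul 3).div (hp 4) (hn 4))).add
      ((hs.const_mul 3).div (hp 5) (hn 5))).congr_deriv ?_
    simp only [sincDeriv, Pi.neg_apply]; push_cast; field_simp; ring
  · refine ((((hc.neg.div (hp 4) (hn 4)).add ((hs.const_mul 6).div (hp 5) (hn 5))).add
      ((hc.const_mul 15).div (hp 6) (hn 6))).sub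
      ((hs.const_mul 15).div (hp 7) (hn 7))).congr_deriv ?_
    simp only [sincDeriv, Pi.neg_apply]; push_cast; field_simp; ring

theorem differentiableAt_sincDeriv_four {w : ℝ} (hw : w ≠ 0) :
    DifferentiableAt ℝ (sincDeriv 4) w := by
  unfold sincDeriv
  fun_prop (disch := simp [hw])

/-- The first odd derivatives, and the second one, at `0` of `ξ ↦ ξ sin ω / ω` with
`ω = √(m² + ξ²)`. -/
theorem iteratedDeriv_mul_sinc {m : ℝ} (hm : 0 < m) :
    let g : ℝ → ℝ := fun ξ => ξ * (Real.sin (Real.sqrt (m ^ 2 + ξ ^ 2)) / Real.sqrt (m ^ 2 + ξ ^ 2))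
    iteratedDeriv 1 g 0 = sincDeriv 0 m ∧ iteratedDeriv 2 g 0 = 0 ∧
      iteratedDeriv 3 g 0 = 3 * sincDeriv 1 m ∧ iteratedDeriv 5 g 0 = 15 * sincDeriv 2 m := by
  intro g
  let w : ℝ → ℝ := fun ξ => Real.sqrt (m ^ 2 + ξ ^ 2)
  have hpos : ∀ ξ : ℝ, 0 < m ^ 2 + ξ ^ 2 := fun ξ => by positivity
  have hw0 : ∀ ξ, w ξ ≠ 0 := fun ξ => (Real.sqrt_pos.2 (hpos ξ)).ne'
  have hw : ∀ ξ, HasDerivAt w (ξ / w ξ) ξ := fun ξ => by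
    refine (((hasDerivAt_pow 2 ξ).const_add (m ^ 2)).sqrt (hpos ξ).ne').congr_deriv ?_
    have := hw0 ξ
    simp only [w] at this ⊢
    push_cast; field_simp
  let H : ℕ → ℝ → ℝ := fun k ξ => sincDeriv k (w ξ)
  have hH : ∀ k < 4, ∀ ξ, HasDerivAt (H k) (ξ * H (k + 1) ξ) ξ := fun k hk ξ => by
    refine ((hasDerivAt_sincDeriv hk (hw0 ξ)).comp ξ (hw ξ)).congr_deriv ?_
    have := hw0 ξ
    simp only [H]
    field_simp
  have hH4 : ∀ ξ, HasDerivAt (H 4) (deriv (H 4) ξ) ξ := fun ξ =>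
    ((differentiableAt_sincDeriv_four (hw0 ξ)).comp ξ (hw ξ).differentiableAt).hasDerivAt
  let F : ℕ → ℝ → ℝ := fun k ξ => match k with
    | 0 => ξ * H 0 ξ
    | 1 => H 0 ξ + ξ ^ 2 * H 1 ξ
    | 2 => 3 * ξ * H 1 ξ + ξ ^ 3 * H 2 ξ
    | 3 => 3 * H 1 ξ + 6 * ξ ^ 2 * H 2 ξ + ξ ^ 4 * H 3 ξ
    | 4 => 15 * ξ * H 2 ξ + 10 * ξ ^ 3 * H 3 ξ + ξ ^ 5 * H 4 ξ
    | _ => 15 * H 2 ξ + 45 * ξ ^ 2 * H 3 ξ + 15 * ξ ^ 4 * H 4 ξ + ξ ^ 5 * deriv (H 4) ξ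
  have hF : ∀ k < 5, ∀ ξ, HasDerivAt (F k) (F (k + 1) ξ) ξ := by
    intro k hk ξ
    have h0 := hH 0 (by norm_num) ξ
    have h1 := hH 1 (by norm_num) ξ
    have h2 := hH 2 (by norm_num) ξ
    have h3 := hH 3 (by norm_num) ξ
    have h4 := hH4 ξ
    have hi := hasDerivAt_id' ξ
    have hp : ∀ n : ℕ, HasDerivAt (fun y : ℝ => y ^ n) (n * ξ ^ (n - 1)) ξ :=
      fun n => hasDerivAt_pow n ξ
    interval_cases k
    · refine (hi.mul h0).congr_deriv ?_
      simp only [F]; ring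
    · refine (h0.add ((hp 2).mul h1)).congr_deriv ?_
      simp only [F]; push_cast; ring
    · refine (((hi.const_mul 3).mul h1).add ((hp 3).mul h2)).congr_deriv ?_
      simp only [F]; push_cast; ring
    · refine (((h1.const_mul 3).add (((hp 2).const_mul 6).mul h2)).add
        ((hp 4).mul h3)).congr_deriv ?_
      simp only [F]; push_cast; ring
    · refine ((((hi.const_mul 15).mul h2).add (((hp 3).const_mul 10).mul h3)).add
        ((hp 5).mul h4)).congr_deriv ?_
      simp only [F]; push_cast; ring
  have key : ∀ n ≤ 5, iteratedDeriv n g 0 = F n 0 := fun n hn =>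
    congrFun (iteratedDeriv_eq_of_hasDerivAt fun k hk => hF k (hk.trans_le hn)) 0
  have hw_zero : w 0 = m := by simp [w, Real.sqrt_sq hm.le]
  refine ⟨?_, ?_, ?_, ?_⟩ <;> rw [key _ (by norm_num)] <;> simp [F, H, hw_zero]

theorem contDiff_theta {m : ℝ} (hm : 0 < m) {n : ℕ} : ContDiff ℝ n (theta m) := by
  have hw : ContDiff ℝ n fun ξ : ℝ => Real.sqrt (m ^ 2 + ξ ^ 2) :=
    ContDiff.sqrt (by fun_prop) fun ξ => by positivity
  have hpos : ∀ ξ : ℝ, 0 < m ^ 2 + ξ ^ 2 * Real.cos (Real.sqrt (m ^ 2 + ξ ^ 2)) ^ 2 :=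
    fun ξ => by positivity
  have hden : ContDiff ℝ n fun ξ : ℝ =>
      Real.sqrt (m ^ 2 + ξ ^ 2 * Real.cos (Real.sqrt (m ^ 2 + ξ ^ 2)) ^ 2) :=
    ContDiff.sqrt (contDiff_const.add ((contDiff_id.pow 2).mul (hw.cos.pow 2)))
      fun ξ => (hpos ξ).ne'
  exact ((contDiff_id.mul hw.sin).div hden fun ξ => (Real.sqrt_pos.2 (hpos ξ)).ne').arctan

theorem sin_theta {m : ℝ} (hm : 0 < m) (ξ : ℝ) :
    Real.sin (theta m ξ) =
      ξ * (Real.sin (Real.sqrt (m ^ 2 + ξ ^ 2)) / Real.sqrt (m ^ 2 + ξ ^ 2)) := by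
  have hsq := Real.sq_sqrt (show 0 ≤ m ^ 2 + ξ ^ 2 by positivity)
  have hw : 0 < Real.sqrt (m ^ 2 + ξ ^ 2) := Real.sqrt_pos.2 (by positivity)
  rw [theta, Real.sin_arctan]
  set w := Real.sqrt (m ^ 2 + ξ ^ 2)
  have hpos : 0 < m ^ 2 + ξ ^ 2 * Real.cos w ^ 2 := by positivity
  have hd : 0 < Real.sqrt (m ^ 2 + ξ ^ 2 * Real.cos w ^ 2) := Real.sqrt_pos.2 hpos
  have hone : 1 + (ξ * Real.sin w / Real.sqrt (m ^ 2 + ξ ^ 2 * Real.cos w ^ 2)) ^ 2 =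
      (w / Real.sqrt (m ^ 2 + ξ ^ 2 * Real.cos w ^ 2)) ^ 2 := by
    rw [div_pow, div_pow, Real.sq_sqrt hpos.le, hsq]
    field_simp
    rw [Real.cos_sq']
    ring
  rw [hone, Real.sqrt_sq (by positivity)]
  field_simp

theorem iteratedDeriv_theta_zero {m : ℝ} (hm : 0 < m) :
    iteratedDeriv 3 (theta m) 0 = 3 * sincDeriv 1 m + sincDeriv 0 m ^ 3 ∧
    iteratedDeriv 5 (theta m) 0 = 15 * sincDeriv 2 m
      + 10 * sincDeriv 0 m ^ 2 * iteratedDeriv 3 (theta m) 0 - sincDeriv 0 m ^ 5 := by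
  obtain ⟨h1, h2, h3, h5⟩ := iteratedDeriv_sin_comp (contDiff_theta hm (n := 5)) (x := 0) (by simp [theta])
  obtain ⟨g1, g2, g3, g5⟩ := iteratedDeriv_mul_sinc hm
  simp only [sin_theta hm] at h1 h2 h3 h5
  rw [g1] at h1
  rw [g2] at h2
  rw [g3, ← h1] at h3
  rw [g5, ← h1, ← h2] at h5
  exact ⟨by linarith, by linarith⟩

/-- On the exceptional set, the third and fifth derivatives reduce to trigonometric identities. -/
theorem trig_identities_of_mem_SigmaSet {m : ℝ} (hm : m ∈ SigmaSet) :
    m * Real.cos m = Real.sin m - Real.sin m ^ 3 / 3 ∧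
    m ^ 3 * iteratedDeriv 5 (theta m) 0 =
      -15 * Real.sin m + (15 * Real.sin m ^ 3 - Real.sin m ^ 5) / m ^ 2 := by
  obtain ⟨hpos, h3⟩ := hm
  obtain ⟨e3, e5⟩ := iteratedDeriv_theta_zero hpos
  rw [h3] at e3 e5
  simp only [sincDeriv] at e3 e5
  have hcos : m * Real.cos m = Real.sin m - Real.sin m ^ 3 / 3 := by
    field_simp at e3
    linarith
  refine ⟨hcos, ?_⟩
  rw [e5]
  field_simp
  linear_combination (-45) * hcos

theorem abs_fifth_derivative_sub_le {m : ℝ} (hm : m ∈ SigmaSet) :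
    |(|m ^ 3 * iteratedDeriv 5 (theta m) 0| - 15)| ≤ 31 / m ^ 2 := by
  obtain ⟨hcos, h5⟩ := trig_identities_of_mem_SigmaSet hm
  have hpos : 0 < m := hm.1
  set s := Real.sin m
  set c := Real.cos m
  have hsc : s ^ 2 + c ^ 2 = 1 := Real.sin_sq_add_cos_sq m
  have hs : |s| ≤ 1 := Real.abs_sin_le_one m
  have hs0 := abs_nonneg s
  have hs2 : |s| ^ 2 = s ^ 2 := sq_abs s
  have hs3 : |s| ^ 3 ≤ 1 := pow_le_one₀ hs0 hs
  have hs5 : |s| ^ 5 ≤ 1 := pow_le_one₀ hs0 hs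
  have hmc : (m * c) ^ 2 ≤ 1 := by
    have h1 : (m * c) ^ 2 = s ^ 2 * (1 - s ^ 2 / 3) ^ 2 := by rw [hcos]; ring
    have h2 : s ^ 2 ≤ 1 := by nlinarith
    have h3 : (1 - s ^ 2 / 3) ^ 2 ≤ 1 := by nlinarith [sq_nonneg s]
    rw [h1]
    exact mul_le_one₀ h2 (sq_nonneg _) h3
  have hc : c ^ 2 ≤ 1 / m ^ 2 := by
    rw [le_div_iff₀ (by positivity)]
    linarith [mul_pow m c 2]
  have hdefect : |(|(-15) * s| - 15)| ≤ 15 * (1 / m ^ 2) := by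
    rw [abs_mul, abs_of_nonpos (by norm_num; linarith)]
    norm_num [-one_div]
    nlinarith
  have herr : |(15 * s ^ 3 - s ^ 5) / m ^ 2| ≤ 16 / m ^ 2 := by
    rw [abs_div, abs_of_pos (show 0 < m ^ 2 by positivity)]
    gcongr
    calc |15 * s ^ 3 - s ^ 5| ≤ |15 * s ^ 3| + |s ^ 5| := abs_sub _ _
      _ = 15 * |s| ^ 3 + |s| ^ 5 := by rw [abs_mul, abs_pow, abs_pow]; norm_num
      _ ≤ 16 := by linarith
  rw [h5]
  calc |(|-15 * s + (15 * s ^ 3 - s ^ 5) / m ^ 2| - 15)|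
      ≤ |(|-15 * s + (15 * s ^ 3 - s ^ 5) / m ^ 2| - |(-15) * s|)| + |(|(-15) * s| - 15)| :=
        abs_sub_le _ _ _
    _ ≤ 16 / m ^ 2 + 15 * (1 / m ^ 2) := by
        refine add_le_add ((abs_abs_sub_abs_le _ _).trans ?_) hdefect
        rwa [add_sub_cancel_left]
    _ = 31 / m ^ 2 := by ring

theorem fifth_derivative_asymptotics_on_Sigma :
    ∃ C > 0, ∃ M > 0, ∀ m ∈ SigmaSet, M ≤ m →
      iteratedDeriv 5 (theta m) 0 ≠ 0 ∧
      |(|m ^ 3 * iteratedDeriv 5 (theta m) 0| - 15)| ≤ C / m ^ 2 := by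
  refine ⟨31, by norm_num, 2, by norm_num, fun m hm hM => ?_⟩
  have hle := abs_fifth_derivative_sub_le hm
  refine ⟨fun h => ?_, hle⟩
  have hlt : (31 : ℝ) / m ^ 2 < 15 := by
    rw [div_lt_iff₀ (by positivity)]
    nlinarith
  rw [h] at hle
  norm_num at hle
  linarith

end
end

section
/- For every m>0, the third derivative of θ(·;m) at the origin satisfies ∂_ξ³θ(ξ;m)|_{ξ=0} = (1/m³)·(−2·sin³(m) + 3·m·cos(m) − 3·sin(m)·cos²(m)). -/
noncomputable section

open Filter Topology

/-- The second derivative at the origin of an even function `x ↦ G (x ^ 2)`. -/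
lemma deriv_deriv_comp_sq_zero {G : ℝ → ℝ} (hG : ContDiffAt ℝ 1 G 0) :
    deriv (deriv fun x => G (x ^ 2)) 0 = 2 * deriv G 0 := by
  have hsq : Tendsto (fun x : ℝ => x ^ 2) (𝓝 0) (𝓝 0) := by
    simpa using (continuous_pow 2).tendsto (0 : ℝ)
  have hG' : ContinuousAt (deriv G) 0 :=
    (hG.derivWithin (m := 0) (by simp)).continuousAt
  have hd : deriv (fun x => G (x ^ 2)) =ᶠ[𝓝 0] fun x => x * (2 * deriv G (x ^ 2)) := by
    filter_upwards [hsq.eventually (hG.eventually (by simp))] with x hx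
    have h := HasDerivAt.comp (h₂ := G) (h := fun x => x ^ 2) x
      (hx.differentiableAt (by simp)).hasDerivAt (hasDerivAt_pow 2 x)
    refine h.deriv.trans ?_
    simp
    ring
  rw [hd.deriv_eq]
  refine HasDerivAt.deriv ?_
  rw [hasDerivAt_iff_tendsto_slope]
  have hlim : Tendsto (fun x => 2 * deriv G (x ^ 2)) (𝓝[≠] 0) (𝓝 (2 * deriv G 0)) :=
    ((hG'.tendsto.comp hsq).const_mul 2).mono_left nhdsWithin_le_nhds
  refine hlim.congr' ?_
  filter_upwards [self_mem_nhdsWithin] with x hx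
  have hx : x ≠ 0 := hx
  simp [slope_def_field, hx]

/-- The third derivative at the origin of the odd function `x ↦ arctan (x * H (x ^ 2))`. -/
lemma iteratedDeriv_three_arctan_mul_comp_sq_zero {H : ℝ → ℝ} (hH : ContDiffAt ℝ 2 H 0) :
    iteratedDeriv 3 (fun x => Real.arctan (x * H (x ^ 2))) 0 =
      6 * deriv H 0 - 2 * H 0 ^ 3 := by
  have hsq : Tendsto (fun x : ℝ => x ^ 2) (𝓝 0) (𝓝 0) := by
    simpa using (continuous_pow 2).tendsto (0 : ℝ)
  have hH' : ContDiffAt ℝ 1 (deriv H) 0 := hH.derivWithin (by norm_num [one_add_one_eq_two])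
  let G : ℝ → ℝ := fun u => (H u + 2 * u * deriv H u) / (1 + u * H u ^ 2)
  have hH1 : ContDiffAt ℝ 1 H 0 := hH.of_le (by norm_num)
  have hG : ContDiffAt ℝ 1 G 0 := by
    refine ContDiffAt.div ?_ ?_ (by simp) <;> fun_prop
  have hd : deriv (fun x => Real.arctan (x * H (x ^ 2))) =ᶠ[𝓝 0] fun x => G (x ^ 2) := by
    filter_upwards [hsq.eventually (hH.eventually (by simp))] with x hx
    have h := HasDerivAt.comp (h₂ := H) (h := fun x => x ^ 2) x
      (hx.differentiableAt (by simp)).hasDerivAt (hasDerivAt_pow 2 x)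
    refine ((hasDerivAt_id x).mul h).arctan.deriv.trans ?_
    simp [G]
    field_simp
  have hG0 : HasDerivAt G (3 * deriv H 0 - H 0 ^ 3) 0 := by
    have h1 := (hH.differentiableAt (by simp)).hasDerivAt
    have h2 := (hH'.differentiableAt (by simp)).hasDerivAt
    have hid := hasDerivAt_id (0 : ℝ)
    refine ((h1.add ((hid.const_mul 2).mul h2)).div
      ((hid.mul (h1.pow 2)).const_add 1) (by simp)).congr_deriv ?_
    simp
    ring
  rw [iteratedDeriv_succ', iteratedDeriv_succ', iteratedDeriv_one, hd.deriv.deriv_eq,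
    deriv_deriv_comp_sq_zero hG, hG0.deriv]
  ring

theorem theta_third_derivative_at_zero (m : ℝ) (hm : 0 < m) :
    iteratedDeriv 3 (theta m) 0 =
      (1 / m ^ 3) *
        (-2 * Real.sin m ^ 3 + 3 * m * Real.cos m - 3 * Real.sin m * Real.cos m ^ 2) := by
  let H : ℝ → ℝ := fun u => Real.sin (Real.sqrt (m ^ 2 + u)) /
    Real.sqrt (m ^ 2 + u * Real.cos (Real.sqrt (m ^ 2 + u)) ^ 2)
  have hθ : theta m = fun x => Real.arctan (x * H (x ^ 2)) := by
    funext x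
    simp only [theta, H, mul_div_assoc]
  have hm0 : m ≠ 0 := hm.ne'
  have hs : Real.sqrt (m ^ 2) = m := Real.sqrt_sq hm.le
  have hw : ContDiffAt ℝ 2 (fun u : ℝ => Real.sqrt (m ^ 2 + u)) 0 :=
    ContDiffAt.sqrt (by fun_prop) (by simp [hm0])
  have hD : ContDiffAt ℝ 2
      (fun u : ℝ => Real.sqrt (m ^ 2 + u * Real.cos (Real.sqrt (m ^ 2 + u)) ^ 2)) 0 :=
    ContDiffAt.sqrt (contDiffAt_const.add (contDiffAt_id.mul (hw.cos.pow 2))) (by simp [hm0])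
  have hH : ContDiffAt ℝ 2 H 0 := hw.sin.div hD (by simp [hs, hm0])
  have hH0 : H 0 = Real.sin m / m := by simp [H, hs]
  have hH' : HasDerivAt H
      (Real.cos m / (2 * m ^ 2) - Real.sin m * Real.cos m ^ 2 / (2 * m ^ 3)) 0 := by
    have hw' : HasDerivAt (fun u : ℝ => Real.sqrt (m ^ 2 + u)) (1 / (2 * m)) 0 := by
      refine (((hasDerivAt_id (0 : ℝ)).const_add (m ^ 2)).sqrt (by simp [hm0])).congr_deriv ?_
      simp [hs]
    have hD' := (((hasDerivAt_id (0 : ℝ)).mul (hw'.cos.pow 2)).const_add (m ^ 2)).sqrt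
      (by simp [hm0])
    refine (hw'.sin.div hD' (by simp [hs, hm0])).congr_deriv ?_
    simp [hs]
    field_simp
  rw [hθ, iteratedDeriv_three_arctan_mul_comp_sq_zero hH, hH'.deriv, hH0]
  field_simp
  ring

end
end

section
/- For every m>0, the fifth derivative of θ(·;m) at the origin satisfies ∂_ξ⁵θ(ξ;m)|_{ξ=0} = (3/m⁵)·(−5·m·cos(m) + 3·sin(m)·cos⁴(m) + 12·sin(m) − 10·m·cos³(m) − 5·m²·sin(m) − 4·sin³(m)). -/
noncomputable section

/-- The fifth derivative at the origin of a function which behaves like `arcsin ∘ f₀`, where `w`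
plays the role of `(1 - f₀ ^ 2) ^ (-1 / 2)` and the even derivatives of `f₀` vanish at `0`. -/
lemma iteratedDeriv_five_of_arcsin_type {g w f₀ f₁ f₂ f₃ f₄ : ℝ → ℝ} {b : ℝ}
    (hg : ∀ x, HasDerivAt g (f₁ x * w x) x)
    (hw : ∀ x, HasDerivAt w (f₀ x * f₁ x * w x ^ 3) x)
    (h₀ : ∀ x, HasDerivAt f₀ (f₁ x) x) (h₁ : ∀ x, HasDerivAt f₁ (f₂ x) x)
    (h₂ : ∀ x, HasDerivAt f₂ (f₃ x) x) (h₃ : ∀ x, HasDerivAt f₃ (f₄ x) x)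
    (h₄ : HasDerivAt f₄ b 0) (z₀ : f₀ 0 = 0) (z₂ : f₂ 0 = 0) (z₄ : f₄ 0 = 0) (zw : w 0 = 1) :
    iteratedDeriv 5 g 0 = b + 10 * f₁ 0 ^ 2 * f₃ 0 + 9 * f₁ 0 ^ 5 := by
  have d₁ : deriv g = fun x => f₁ x * w x := funext fun x => (hg x).deriv
  have d₂ : deriv (fun x => f₁ x * w x) = fun x => f₂ x * w x + f₀ x * f₁ x ^ 2 * w x ^ 3 := by
    funext x
    refine HasDerivAt.deriv ?_
    refine HasDerivAt.congr_deriv ((h₁ x).fun_mul (hw x)) ?_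
    ring
  have d₃ : deriv (fun x => f₂ x * w x + f₀ x * f₁ x ^ 2 * w x ^ 3) = fun x =>
      f₃ x * w x + (3 * f₀ x * f₁ x * f₂ x + f₁ x ^ 3) * w x ^ 3
        + 3 * f₀ x ^ 2 * f₁ x ^ 3 * w x ^ 5 := by
    funext x
    refine HasDerivAt.deriv ?_
    refine HasDerivAt.congr_deriv (((h₂ x).fun_mul (hw x)).fun_add
      (((h₀ x).fun_mul ((h₁ x).fun_pow 2)).fun_mul ((hw x).fun_pow 3))) ?_
    norm_num
    ring
  have d₄ : deriv (fun x =>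
      f₃ x * w x + (3 * f₀ x * f₁ x * f₂ x + f₁ x ^ 3) * w x ^ 3
        + 3 * f₀ x ^ 2 * f₁ x ^ 3 * w x ^ 5) = fun x =>
      f₄ x * w x + (4 * f₀ x * f₁ x * f₃ x + 6 * f₁ x ^ 2 * f₂ x + 3 * f₀ x * f₂ x ^ 2) * w x ^ 3
        + (18 * f₀ x ^ 2 * f₁ x ^ 2 * f₂ x + 9 * f₀ x * f₁ x ^ 4) * w x ^ 5
        + 15 * f₀ x ^ 3 * f₁ x ^ 4 * w x ^ 7 := by
    funext x
    refine HasDerivAt.deriv ?_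
    refine HasDerivAt.congr_deriv ((((h₃ x).fun_mul (hw x)).fun_add
      ((((((h₀ x).const_mul 3).fun_mul (h₁ x)).fun_mul (h₂ x)).fun_add
        ((h₁ x).fun_pow 3)).fun_mul ((hw x).fun_pow 3))).fun_add
      (((((h₀ x).fun_pow 2).const_mul 3).fun_mul ((h₁ x).fun_pow 3)).fun_mul
        ((hw x).fun_pow 5))) ?_
    norm_num
    ring
  rw [iteratedDeriv_succ', d₁, iteratedDeriv_succ', d₂, iteratedDeriv_succ', d₃,
    iteratedDeriv_succ', d₄, iteratedDeriv_one]
  refine HasDerivAt.deriv ?_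
  refine HasDerivAt.congr_deriv ((((h₄.fun_mul (hw 0)).fun_add
    (((((((h₀ 0).const_mul 4).fun_mul (h₁ 0)).fun_mul (h₃ 0)).fun_add
      ((((h₁ 0).fun_pow 2).const_mul 6).fun_mul (h₂ 0))).fun_add
      (((h₀ 0).const_mul 3).fun_mul ((h₂ 0).fun_pow 2))).fun_mul ((hw 0).fun_pow 3))).fun_add
    (((((((h₀ 0).fun_pow 2).const_mul 18).fun_mul ((h₁ 0).fun_pow 2)).fun_mul (h₂ 0)).fun_add
      (((h₀ 0).const_mul 9).fun_mul ((h₁ 0).fun_pow 4))).fun_mul ((hw 0).fun_pow 5))).fun_add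
    (((((h₀ 0).fun_pow 3).const_mul 15).fun_mul ((h₁ 0).fun_pow 4)).fun_mul
      ((hw 0).fun_pow 7))) ?_
  norm_num [z₀, z₂, z₄, zw]
  ring

/-- The version of `iteratedDeriv_five_of_arcsin_type` for `f₀ x = x * A (x ^ 2)`, where `aₖ` is
the `k`-th derivative of `A` at `x ^ 2`. -/
lemma iteratedDeriv_five_of_arcsin_type_odd {g w a₀ a₁ a₂ a₃ a₄ : ℝ → ℝ}
    (hg : ∀ x, HasDerivAt g ((a₀ x + 2 * x ^ 2 * a₁ x) * w x) x)
    (hw : ∀ x, HasDerivAt w (x * a₀ x * (a₀ x + 2 * x ^ 2 * a₁ x) * w x ^ 3) x)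
    (h₀ : ∀ x, HasDerivAt a₀ (2 * x * a₁ x) x) (h₁ : ∀ x, HasDerivAt a₁ (2 * x * a₂ x) x)
    (h₂ : ∀ x, HasDerivAt a₂ (2 * x * a₃ x) x) (h₃ : ∀ x, HasDerivAt a₃ (2 * x * a₄ x) x)
    (h₄ : DifferentiableAt ℝ a₄ 0) (zw : w 0 = 1) :
    iteratedDeriv 5 g 0 = 60 * a₂ 0 + 60 * a₀ 0 ^ 2 * a₁ 0 + 9 * a₀ 0 ^ 5 := by
  have key := iteratedDeriv_five_of_arcsin_type (g := g) (w := w) (f₀ := fun x => x * a₀ x)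
    (f₁ := fun x => a₀ x + 2 * x ^ 2 * a₁ x)
    (f₂ := fun x => 6 * x * a₁ x + 4 * x ^ 3 * a₂ x)
    (f₃ := fun x => 6 * a₁ x + 24 * x ^ 2 * a₂ x + 8 * x ^ 4 * a₃ x)
    (f₄ := fun x => 60 * x * a₂ x + 80 * x ^ 3 * a₃ x + 16 * x ^ 5 * a₄ x)
    (b := 60 * a₂ 0) hg hw ?_ ?_ ?_ ?_ ?_ (by simp) (by simp) (by simp) zw
  · rw [key]
    ring
  · intro x
    refine HasDerivAt.congr_deriv ((hasDerivAt_id' x).fun_mul (h₀ x)) ?_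
    ring
  · intro x
    refine HasDerivAt.congr_deriv ((h₀ x).fun_add (((hasDerivAt_pow (𝕜 := ℝ) 2 x).const_mul 2).fun_mul (h₁ x))) ?_
    norm_num
    ring
  · intro x
    refine HasDerivAt.congr_deriv ((((hasDerivAt_id' x).const_mul 6).fun_mul (h₁ x)).fun_add
      (((hasDerivAt_pow 3 x).const_mul 4).fun_mul (h₂ x))) ?_
    norm_num
    ring
  · intro x
    refine HasDerivAt.congr_deriv ((((h₁ x).const_mul 6).fun_add
      (((hasDerivAt_pow (𝕜 := ℝ) 2 x).const_mul 24).fun_mul (h₂ x))).fun_add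
      (((hasDerivAt_pow 4 x).const_mul 8).fun_mul (h₃ x))) ?_
    norm_num
    ring
  · refine HasDerivAt.congr_deriv (((((hasDerivAt_id' (0 : ℝ)).const_mul 60).fun_mul (h₂ 0)).fun_add
      (((hasDerivAt_pow 3 (0 : ℝ)).const_mul 80).fun_mul (h₃ 0))).fun_add
      (((hasDerivAt_pow 5 (0 : ℝ)).const_mul 16).fun_mul h₄.hasDerivAt)) ?_
    norm_num

theorem theta_fifth_derivative_at_zero (m : ℝ) (hm : 0 < m) :
    iteratedDeriv 5 (theta m) 0 =
      (3 / m ^ 5) *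
        (-5 * m * Real.cos m + 3 * Real.sin m * Real.cos m ^ 4 + 12 * Real.sin m -
          10 * m * Real.cos m ^ 3 - 5 * m ^ 2 * Real.sin m - 4 * Real.sin m ^ 3) := by
  set o : ℝ → ℝ := fun x => Real.sqrt (m ^ 2 + x ^ 2) with ho
  set c : ℝ → ℝ := fun x => Real.cos (o x) with hc
  set S : ℝ → ℝ := fun x => Real.sin (o x) / o x with hS
  set p : ℝ → ℝ := fun x => (m ^ 2 + x ^ 2)⁻¹ with hp
  set q : ℝ → ℝ := fun x => Real.sqrt (m ^ 2 + x ^ 2 * c x ^ 2) with hq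
  have pos (x : ℝ) : 0 < m ^ 2 + x ^ 2 := by positivity
  have posq (x : ℝ) : 0 < m ^ 2 + x ^ 2 * c x ^ 2 := by positivity
  have o_pos (x : ℝ) : 0 < o x := Real.sqrt_pos.2 (pos x)
  have q_pos (x : ℝ) : 0 < q x := Real.sqrt_pos.2 (posq x)
  have o_sq (x : ℝ) : o x ^ 2 = m ^ 2 + x ^ 2 := Real.sq_sqrt (pos x).le
  have q_sq (x : ℝ) : q x ^ 2 = m ^ 2 + x ^ 2 * c x ^ 2 := Real.sq_sqrt (posq x).le
  have p_eq (x : ℝ) : p x = (o x ^ 2)⁻¹ := by rw [o_sq]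
  have o_zero : o 0 = m := by simp [ho, hm.le]
  have q_zero : q 0 = m := by simp [hq, hm.le]
  have sin_eq (x : ℝ) : Real.sin (o x) = S x * o x := by
    have := (o_pos x).ne'
    simp only [hS]
    field_simp
  have trig (x : ℝ) : S x ^ 2 * o x ^ 2 + c x ^ 2 = 1 := by
    rw [← mul_pow, ← sin_eq]
    exact Real.sin_sq_add_cos_sq _
  have q_rel (x : ℝ) : q x ^ 2 = o x ^ 2 - x ^ 2 * S x ^ 2 * o x ^ 2 := by
    linear_combination q_sq x - o_sq x + x ^ 2 * trig x
  have d_sq (x : ℝ) : HasDerivAt (fun x : ℝ => m ^ 2 + x ^ 2) (2 * x) x := by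
    simpa using (hasDerivAt_pow (𝕜 := ℝ) 2 x).const_add (m ^ 2)
  have d_o (x : ℝ) : HasDerivAt o (x / o x) x := by
    refine HasDerivAt.congr_deriv ((d_sq x).sqrt (pos x).ne') ?_
    rw [mul_div_mul_left _ _ two_ne_zero]
  have d_c (x : ℝ) : HasDerivAt c (-x * S x) x := by
    refine HasDerivAt.congr_deriv ((d_o x).cos) ?_
    simp only [hS]
    ring
  have d_S (x : ℝ) : HasDerivAt S (x * (c x - S x) * p x) x := by
    refine HasDerivAt.congr_deriv ((d_o x).sin.fun_div (d_o x) (o_pos x).ne') ?_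
    have := (o_pos x).ne'
    rw [p_eq, sin_eq]
    simp only [hc]
    field_simp
  have d_p (x : ℝ) : HasDerivAt p (-2 * x * p x ^ 2) x := by
    refine HasDerivAt.congr_deriv ((d_sq x).fun_inv (pos x).ne') ?_
    simp only [hp, inv_pow, div_eq_mul_inv, neg_mul]
  have d_q (x : ℝ) : HasDerivAt q ((x * c x ^ 2 - x ^ 3 * c x * S x) / q x) x := by
    refine HasDerivAt.congr_deriv ((((hasDerivAt_pow (𝕜 := ℝ) 2 x).fun_mul ((d_c x).fun_pow 2)).const_add (m ^ 2)).sqrt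
      (posq x).ne') ?_
    have := (q_pos x).ne'
    change _ / (2 * q x) = _
    field_simp
    norm_num
    ring
  have d_g (x : ℝ) : HasDerivAt (theta m)
      ((S x + 2 * x ^ 2 * ((c x - S x) * p x / 2)) * (o x / q x)) x := by
    refine HasDerivAt.congr_deriv ((((hasDerivAt_id' x).fun_mul (d_o x).sin).fun_div (d_q x) (q_pos x).ne').arctan) ?_
    have ho' := (o_pos x).ne'
    have hq' := (q_pos x).ne'
    have hsum : 1 + (x * Real.sin (o x) / q x) ^ 2 = o x ^ 2 / q x ^ 2 := by
      rw [sin_eq]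
      field_simp
      linear_combination q_rel x
    change 1 / (1 + (x * Real.sin (o x) / q x) ^ 2) * _ = _
    rw [hsum, p_eq, sin_eq]
    change 1 / (o x ^ 2 / q x ^ 2) *
      (((1 * (S x * o x) + x * (c x * (x / o x))) * q x -
        x * (S x * o x) * ((x * c x ^ 2 - x ^ 3 * c x * S x) / q x)) / q x ^ 2) = _
    field_simp
    linear_combination (S x * o x ^ 2 + x ^ 2 * c x) * q_rel x - x ^ 2 * S x * o x ^ 2 * trig x
  have d_w (x : ℝ) : HasDerivAt (fun x => o x / q x)
      (x * S x * (S x + 2 * x ^ 2 * ((c x - S x) * p x / 2)) * (o x / q x) ^ 3) x := by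
    refine HasDerivAt.congr_deriv ((d_o x).fun_div (d_q x) (q_pos x).ne') ?_
    have ho' := (o_pos x).ne'
    have hq' := (q_pos x).ne'
    rw [p_eq]
    field_simp
    linear_combination x * q_rel x - x * o x ^ 2 * trig x
  have key := iteratedDeriv_five_of_arcsin_type_odd (g := theta m) (w := fun x => o x / q x)
    (a₀ := S) (a₁ := fun x => (c x - S x) * p x / 2)
    (a₂ := fun x => -(S x * p x) / 4 - 3 / 4 * ((c x - S x) * p x ^ 2))
    (a₃ := fun x => 5 / 8 * (S x * p x ^ 2) - 1 / 8 * ((c x - S x) * p x ^ 2)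
      + 15 / 8 * ((c x - S x) * p x ^ 3))
    (a₄ := fun x => 5 / 8 * ((c x - S x) * p x ^ 3) - 35 / 16 * (S x * p x ^ 3)
      + 1 / 16 * (S x * p x ^ 2) - 105 / 16 * ((c x - S x) * p x ^ 4))
    d_g d_w ?_ ?_ ?_ ?_ ?_ (by simp [o_zero, q_zero, hm.ne'])
  · have S_zero : S 0 = Real.sin m / m := by simp only [hS, o_zero]
    have c_zero : c 0 = Real.cos m := by simp only [hc, o_zero]
    rw [key]
    simp only [S_zero, c_zero, p_eq, o_zero]
    have hs : Real.cos m ^ 2 = 1 - Real.sin m ^ 2 := Real.cos_sq' m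
    have h3 : Real.cos m ^ 3 = Real.cos m * (1 - Real.sin m ^ 2) := by rw [← hs]; ring
    have h4 : Real.cos m ^ 4 = (1 - Real.sin m ^ 2) ^ 2 := by rw [← hs]; ring
    rw [h3, h4]
    field_simp
    ring
  · intro x
    refine HasDerivAt.congr_deriv (d_S x) ?_
    ring
  · intro x
    refine HasDerivAt.congr_deriv ((((d_c x).fun_sub (d_S x)).fun_mul (d_p x)).div_const 2) ?_
    ring
  · intro x
    refine HasDerivAt.congr_deriv ((((d_S x).fun_mul (d_p x)).fun_neg.div_const 4).fun_sub
      ((((d_c x).fun_sub (d_S x)).fun_mul ((d_p x).fun_pow 2)).const_mul (3 / 4))) ?_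
    norm_num
    ring
  · intro x
    refine HasDerivAt.congr_deriv (((((d_S x).fun_mul ((d_p x).fun_pow 2)).const_mul (5 / 8)).fun_sub
      ((((d_c x).fun_sub (d_S x)).fun_mul ((d_p x).fun_pow 2)).const_mul (1 / 8))).fun_add
      ((((d_c x).fun_sub (d_S x)).fun_mul ((d_p x).fun_pow 3)).const_mul (15 / 8))) ?_
    norm_num
    ring
  · have e_c := (d_c 0).differentiableAt
    have e_S := (d_S 0).differentiableAt
    have e_p := (d_p 0).differentiableAt
    fun_prop

end
end

section
/- Let λ:ℝ→ℝ be smooth with λ'(0)=λ''(0)=0 and λ'''(0)≠0. Then there exists δ>0 (depending on λ) such that for every smooth compactly supported f:ℝ→ℂ with supp f ⊂ (−δ,δ), there exist C>0 and ω₀>0 with | ∫_ℝ f(z)·e^{iωλ(z)}·dz − 2π·e^{iλ(0)ω}·Ai(0)·f(0)·(2/|λ'''(0)|)^{1/3}·ω^{−1/3} | ≤ C·ω^{−2/3} for all ω ≥ ω₀, where Ai(0) = 1/(3^{2/3}·Γ(2/3)). -/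
open MeasureTheory
noncomputable section

theorem norm_cexp_neg_mul_cube (r : ℂ) (u : ℝ) :
    ‖Complex.exp (-r * (u : ℂ) ^ 3)‖ = Real.exp (-r.re * u ^ 3) := by
  rw [Complex.norm_exp]
  congr 1
  rw [← Complex.ofReal_pow, Complex.re_mul_ofReal]
  simp

theorem integrableOn_pow_mul_exp_neg_mul_cube (n : ℕ) {b : ℝ} (hb : 0 < b) :
    IntegrableOn (fun u : ℝ => u ^ n * Real.exp (-b * u ^ 3)) (Set.Ioi 0) := by
  have h := integrableOn_rpow_mul_exp_neg_mul_rpow (s := n) (p := 3)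
    (by have : (0 : ℝ) ≤ n := n.cast_nonneg
        linarith) (by norm_num) hb
  refine h.congr_fun (fun u _ => ?_) measurableSet_Ioi
  simp only [Real.rpow_natCast]
  norm_cast

theorem integrableOn_cexp_neg_mul_cube {r : ℂ} (hr : 0 < r.re) :
    IntegrableOn (fun u : ℝ => Complex.exp (-r * (u : ℂ) ^ 3)) (Set.Ioi 0) := by
  refine ((integrableOn_pow_mul_exp_neg_mul_cube 0 hr).mono'
    (Continuous.aestronglyMeasurable (by fun_prop)) ?_)
  refine Filter.Eventually.of_forall fun u => ?_
  rw [norm_cexp_neg_mul_cube, pow_zero, one_mul]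

theorem hasDerivAt_integral_cexp_neg_mul_cube {r : ℂ} (hr : 0 < r.re) :
    HasDerivAt (fun r : ℂ => ∫ u : ℝ in Set.Ioi 0, Complex.exp (-r * (u : ℂ) ^ 3))
      (∫ u : ℝ in Set.Ioi 0, -(u : ℂ) ^ 3 * Complex.exp (-r * (u : ℂ) ^ 3)) r := by
  have hs : {w : ℂ | r.re / 2 < w.re} ∈ nhds r :=
    (isOpen_lt continuous_const Complex.continuous_re).mem_nhds (by simpa using hr)
  refine (hasDerivAt_integral_of_dominated_loc_of_deriv_le
    (F := fun (w : ℂ) (u : ℝ) => Complex.exp (-w * (u : ℂ) ^ 3))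
    (F' := fun (w : ℂ) (u : ℝ) => -(u : ℂ) ^ 3 * Complex.exp (-w * (u : ℂ) ^ 3))
    (bound := fun u : ℝ => u ^ 3 * Real.exp (-(r.re / 2) * u ^ 3)) hs
    (Filter.Eventually.of_forall fun w => Continuous.aestronglyMeasurable (by fun_prop))
    (integrableOn_cexp_neg_mul_cube hr) (Continuous.aestronglyMeasurable (by fun_prop)) ?_
    (integrableOn_pow_mul_exp_neg_mul_cube 3 (half_pos hr)) ?_).2
  · refine (ae_restrict_iff' measurableSet_Ioi).2 (Filter.Eventually.of_forall fun u hu w hw => ?_)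
    have hu' : 0 ≤ u ^ 3 := pow_nonneg (le_of_lt hu) 3
    rw [norm_mul, norm_cexp_neg_mul_cube, norm_neg, ← Complex.ofReal_pow, Complex.norm_real,
      Real.norm_of_nonneg hu']
    have hw' : r.re / 2 < w.re := hw
    gcongr
  · refine Filter.Eventually.of_forall fun u w _ => ?_
    refine (((hasDerivAt_id w).neg).mul_const ((u : ℂ) ^ 3)).cexp.congr_deriv ?_
    simp [mul_comm]

/-- The Laplace transform of the cubic phase on the right half-plane. -/
theorem integral_cexp_neg_mul_cube {r : ℂ} (hr : 0 < r.re) :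
    ∫ u : ℝ in Set.Ioi 0, Complex.exp (-r * (u : ℂ) ^ 3) =
      Real.Gamma (1 / 3 + 1) * r ^ (-(1 / 3) : ℂ) := by
  have hU : IsOpen {w : ℂ | 0 < w.re} := isOpen_lt continuous_const Complex.continuous_re
  have h1 : AnalyticOnNhd ℂ (fun r : ℂ => ∫ u : ℝ in Set.Ioi 0, Complex.exp (-r * (u : ℂ) ^ 3))
      {w : ℂ | 0 < w.re} :=
    DifferentiableOn.analyticOnNhd (fun w hw =>
      (hasDerivAt_integral_cexp_neg_mul_cube hw).differentiableAt.differentiableWithinAt) hU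
  have h2 : AnalyticOnNhd ℂ (fun r : ℂ => (Real.Gamma (1 / 3 + 1) : ℂ) * r ^ (-(1 / 3) : ℂ))
      {w : ℂ | 0 < w.re} :=
    DifferentiableOn.analyticOnNhd (fun w hw =>
      ((differentiableAt_id.cpow_const (Or.inl hw)).const_mul _).differentiableWithinAt) hU
  refine h1.eqOn_of_preconnected_of_frequently_eq h2
    (convex_halfSpace_re_gt 0).isPreconnected (z₀ := 1) (by simp) ?_ hr
  have key : ∀ x : ℝ, 0 < x → ∫ u : ℝ in Set.Ioi 0, Complex.exp (-(x : ℂ) * (u : ℂ) ^ 3) =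
      Real.Gamma (1 / 3 + 1) * (x : ℂ) ^ (-(1 / 3) : ℂ) := by
    intro x hx
    have h := integral_exp_neg_mul_rpow (p := 3) (by norm_num) hx
    have e : ∀ u : ℝ, Complex.exp (-(x : ℂ) * (u : ℂ) ^ 3) =
        ((Real.exp (-x * u ^ (3 : ℝ)) : ℝ) : ℂ) := by
      intro u
      norm_cast
    simp_rw [e]
    rw [integral_complex_ofReal, h, Complex.ofReal_mul, Complex.ofReal_cpow hx.le, mul_comm]
    norm_num
  have ht : Filter.Tendsto (fun n : ℕ => ((1 + 1 / ((n : ℝ) + 1) : ℝ) : ℂ)) Filter.atTop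
      (nhdsWithin 1 {1}ᶜ) := by
    refine tendsto_nhdsWithin_iff.2 ⟨?_, Filter.Eventually.of_forall fun n => ?_⟩
    · have := (tendsto_one_div_add_atTop_nhds_zero_nat (𝕜 := ℝ)).const_add 1
      rw [add_zero] at this
      exact (Complex.continuous_ofReal.tendsto' 1 1 Complex.ofReal_one).comp this
    · have : (0 : ℝ) < 1 / ((n : ℝ) + 1) := by positivity
      simp only [Set.mem_compl_iff, Set.mem_singleton_iff]
      intro h
      have h' : (1 + 1 / ((n : ℝ) + 1) : ℝ) = 1 := by exact_mod_cast h
      linarith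
  exact ht.frequently (Filter.Frequently.of_forall fun n => key _ (by positivity))

/-- Tail estimate, uniform in the damping. -/
theorem norm_integral_Ioi_cexp_neg_mul_cube_le {r : ℂ} (hr : 0 < r.re) {A : ℝ} (hA : 0 < A) :
    ‖∫ u : ℝ in Set.Ioi A, Complex.exp (-r * (u : ℂ) ^ 3)‖ ≤ 1 / (‖r‖ * A ^ 2) := by
  have hr0 : r ≠ 0 := by rintro rfl; simp at hr
  have hrn : 0 < ‖r‖ := norm_pos_iff.2 hr0
  set e : ℝ → ℂ := fun u => Complex.exp (-r * (u : ℂ) ^ 3) with he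
  have hepos : ∀ u : ℝ, 0 ≤ u → ‖e u‖ ≤ 1 := by
    intro u hu
    rw [he, norm_cexp_neg_mul_cube, Real.exp_le_one_iff]
    have := mul_nonneg hr.le (pow_nonneg hu 3)
    linarith
  have hed : ∀ u : ℝ, HasDerivAt e (e u * (-r * (3 * (u : ℂ) ^ 2))) u := by
    intro u
    simpa [he] using (((hasDerivAt_pow 3 (u : ℂ)).comp_ofReal).const_mul (-r)).cexp
  have hi3 : IntegrableOn (fun u : ℝ => u ^ (-3 : ℝ)) (Set.Ioi A) :=
    integrableOn_Ioi_rpow_of_lt (by norm_num) hA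
  have hpow : ∀ u : ℝ, 0 < u → u ^ (-3 : ℝ) = 1 / u ^ 3 := by
    intro u hu
    rw [Real.rpow_neg hu.le, one_div]
    norm_cast
  have hcont : Continuous e := by fun_prop
  have hnb : ∀ u ∈ Set.Ioi A, ‖2 / (3 * r * (u : ℂ) ^ 3) * e u‖ ≤
      2 / (3 * ‖r‖) * u ^ (-3 : ℝ) := by
    intro u hu
    have hu0 : 0 < u := hA.trans hu
    rw [norm_mul, hpow u hu0]
    have : ‖2 / (3 * r * (u : ℂ) ^ 3)‖ = 2 / (3 * ‖r‖) * (1 / u ^ 3) := by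
      simp [abs_of_pos hu0]
      field_simp
    rw [this]
    exact mul_le_of_le_one_right (by positivity) (hepos u hu0.le)
  have hi2 : IntegrableOn (fun u : ℝ => 2 / (3 * r * (u : ℂ) ^ 3) * e u) (Set.Ioi A) := by
    refine (hi3.const_mul (2 / (3 * ‖r‖))).mono' ?_
      ((ae_restrict_iff' measurableSet_Ioi).2 (Filter.Eventually.of_forall hnb))
    refine ContinuousOn.aestronglyMeasurable (fun u hu => ?_) measurableSet_Ioi
    have hu0 : (u : ℂ) ≠ 0 := Complex.ofReal_ne_zero.2 (hA.trans hu).ne'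
    have : 3 * r * (u : ℂ) ^ 3 ≠ 0 := by simp [hr0, hu0]
    fun_prop (disch := assumption)
  have hi1 : IntegrableOn e (Set.Ioi A) :=
    (integrableOn_cexp_neg_mul_cube hr).mono_set (Set.Ioi_subset_Ioi hA.le)
  have hF : ∀ u ∈ Set.Ici A, HasDerivAt (fun u : ℝ => -(e u / (3 * r * (u : ℂ) ^ 2)))
      (e u + 2 / (3 * r * (u : ℂ) ^ 3) * e u) u := by
    intro u hu
    have hu0 : (u : ℂ) ≠ 0 := Complex.ofReal_ne_zero.2 (hA.trans_le hu).ne'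
    have hd : HasDerivAt (fun u : ℝ => 3 * r * (u : ℂ) ^ 2) (3 * r * (2 * (u : ℂ))) u := by
      simpa using ((hasDerivAt_pow 2 (u : ℂ)).comp_ofReal).const_mul (3 * r)
    refine ((hed u).div hd (by simp [hr0, hu0])).neg.congr_deriv ?_
    field_simp
    ring
  have hlim : Filter.Tendsto (fun u : ℝ => -(e u / (3 * r * (u : ℂ) ^ 2))) Filter.atTop
      (nhds 0) := by
    have h0 : Filter.Tendsto (fun u : ℝ => 1 / (3 * ‖r‖) * (u ^ 2)⁻¹) Filter.atTop (nhds 0) := by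
      have := (tendsto_inv_atTop_zero.comp (Filter.tendsto_pow_atTop (α := ℝ)
        two_ne_zero)).const_mul (1 / (3 * ‖r‖))
      simpa using this
    refine squeeze_zero_norm' ?_ h0
    filter_upwards [Filter.eventually_gt_atTop 0] with u hu
    rw [norm_neg, norm_div]
    have : ‖3 * r * (u : ℂ) ^ 2‖ = 3 * ‖r‖ * u ^ 2 := by simp
    have h1 : 1 / (3 * ‖r‖) * (u ^ 2)⁻¹ = 1 / (3 * ‖r‖ * u ^ 2) := by field_simp
    rw [this, h1]
    gcongr
    exact hepos u hu.le
  have hint := integral_Ioi_of_hasDerivAt_of_tendsto' hF (hi1.add hi2) hlim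
  have hsum := integral_add hi1 hi2
  rw [hint] at hsum
  have : ∫ u in Set.Ioi A, e u = e A / (3 * r * (A : ℂ) ^ 2) -
      ∫ u in Set.Ioi A, 2 / (3 * r * (u : ℂ) ^ 3) * e u := by
    rw [eq_sub_iff_add_eq, ← hsum]; ring
  rw [this]
  have hb1 : ‖e A / (3 * r * (A : ℂ) ^ 2)‖ ≤ 1 / (3 * ‖r‖ * A ^ 2) := by
    have h : ‖3 * r * (A : ℂ) ^ 2‖ = 3 * ‖r‖ * A ^ 2 := by simp
    rw [norm_div, h]
    gcongr
    exact hepos A hA.le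
  have hb2 : ‖∫ u in Set.Ioi A, 2 / (3 * r * (u : ℂ) ^ 3) * e u‖ ≤ 1 / (3 * ‖r‖ * A ^ 2) := by
    refine (norm_integral_le_of_norm_le (hi3.const_mul (2 / (3 * ‖r‖)))
      ((ae_restrict_iff' measurableSet_Ioi).2 (Filter.Eventually.of_forall hnb))).trans ?_
    rw [integral_const_mul, integral_Ioi_rpow_of_lt (by norm_num) hA]
    have : A ^ (-3 + 1 : ℝ) = 1 / A ^ 2 := by
      rw [show (-3 + 1 : ℝ) = -2 by norm_num, Real.rpow_neg hA.le, one_div]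
      norm_cast
    rw [this]
    apply le_of_eq
    field_simp
    norm_num
  refine (norm_sub_le _ _).trans ((add_le_add hb1 hb2).trans ?_)
  rw [← add_div, div_le_div_iff₀ (by positivity) (by positivity)]
  nlinarith [mul_pos hrn (pow_pos hA 2)]

theorem norm_integral_cexp_I_mul_cube_sub_le {s : ℝ} (hs : s ≠ 0) {A : ℝ} (hA : 0 < A) :
    ‖(∫ u in (0 : ℝ)..A, Complex.exp (Complex.I * s * (u : ℂ) ^ 3)) -
      Real.Gamma (1 / 3 + 1) * (-(Complex.I * s)) ^ (-(1 / 3) : ℂ)‖ ≤ 1 / (|s| * A ^ 2) := by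
  have hsl : -(Complex.I * s) ∈ Complex.slitPlane := Or.inr (by simpa using hs)
  have hlim : Filter.Tendsto (fun η : ℝ => (η : ℂ) - Complex.I * s) (nhdsWithin 0 (Set.Ioi 0))
      (nhds (-(Complex.I * s))) := by
    refine tendsto_nhdsWithin_of_tendsto_nhds (Continuous.tendsto' (by fun_prop) _ _ ?_)
    simp
  have hI : Continuous (fun r : ℂ => ∫ u in (0 : ℝ)..A, Complex.exp (-r * (u : ℂ) ^ 3)) :=
    intervalIntegral.continuous_parametric_intervalIntegral_of_continuous' (by fun_prop) _ _
  have hP : ContinuousAt (fun r : ℂ => (Real.Gamma (1 / 3 + 1) : ℂ) * r ^ (-(1 / 3) : ℂ))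
      (-(Complex.I * s)) := (continuousAt_cpow_const hsl).const_mul _
  have hL := ((hI.tendsto _).sub hP.tendsto).norm.comp hlim
  have hrn : ‖-(Complex.I * (s : ℂ))‖ = |s| := by simp
  have hR : Filter.Tendsto (fun r : ℂ => 1 / (‖r‖ * A ^ 2)) (nhds (-(Complex.I * s)))
      (nhds (1 / (|s| * A ^ 2))) := by
    have : ContinuousAt (fun r : ℂ => 1 / (‖r‖ * A ^ 2)) (-(Complex.I * s)) := by
      have h0 : ‖-(Complex.I * (s : ℂ))‖ * A ^ 2 ≠ 0 := by
        rw [hrn]; have := abs_pos.2 hs; positivity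
      fun_prop (disch := assumption)
    simpa only [ContinuousAt, hrn] using this
  have := le_of_tendsto_of_tendsto hL (hR.comp hlim) ?_
  · simpa using this
  · filter_upwards [self_mem_nhdsWithin] with η hη
    have hr : 0 < ((η : ℂ) - Complex.I * s).re := by simpa using hη
    have hsplit := intervalIntegral.integral_Ioi_sub_Ioi
      (integrableOn_cexp_neg_mul_cube hr) hA.le
    rw [integral_cexp_neg_mul_cube hr] at hsplit
    simp only [Function.comp_apply]
    rw [← hsplit, sub_right_comm, sub_self, zero_sub, norm_neg]
    exact norm_integral_Ioi_cexp_neg_mul_cube_le hr hA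

theorem ofReal_mul_cpow {t : ℝ} (ht : 0 < t) {z : ℂ} (hz : z ≠ 0) (w : ℂ) :
    ((t : ℂ) * z) ^ w = (t : ℂ) ^ w * z ^ w := by
  have ht' : (t : ℂ) ≠ 0 := Complex.ofReal_ne_zero.2 ht.ne'
  rw [Complex.cpow_def_of_ne_zero (mul_ne_zero ht' hz), Complex.cpow_def_of_ne_zero ht',
    Complex.cpow_def_of_ne_zero hz, Complex.log_ofReal_mul ht hz, Complex.ofReal_log ht.le,
    add_mul, Complex.exp_add]

theorem I_mul_cpow_add_neg_I_mul_cpow {s : ℝ} (hs : s ≠ 0) :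
    (-(Complex.I * s)) ^ (-(1 / 3) : ℂ) + (-(Complex.I * (-s : ℝ))) ^ (-(1 / 3) : ℂ) =
      ((√3 * |s| ^ (-(1 / 3) : ℝ) : ℝ) : ℂ) := by
  have key : ∀ t : ℝ, 0 < t →
      (Complex.I * t) ^ (-(1 / 3) : ℂ) + (-(Complex.I * t)) ^ (-(1 / 3) : ℂ) =
      ((√3 * t ^ (-(1 / 3) : ℝ) : ℝ) : ℂ) := by
    intro t ht
    have e1 : (Complex.I * t) ^ (-(1 / 3) : ℂ) =
        (t : ℂ) ^ (-(1 / 3) : ℂ) * Complex.I ^ (-(1 / 3) : ℂ) := by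
      rw [mul_comm, ofReal_mul_cpow ht Complex.I_ne_zero]
    have e2 : (-(Complex.I * t)) ^ (-(1 / 3) : ℂ) =
        (t : ℂ) ^ (-(1 / 3) : ℂ) * (-Complex.I) ^ (-(1 / 3) : ℂ) := by
      rw [← neg_mul, mul_comm, ofReal_mul_cpow ht (neg_ne_zero.2 Complex.I_ne_zero)]
    have e3 : Complex.I ^ (-(1 / 3) : ℂ) + (-Complex.I) ^ (-(1 / 3) : ℂ) = (√3 : ℝ) := by
      rw [Complex.cpow_def_of_ne_zero Complex.I_ne_zero,
        Complex.cpow_def_of_ne_zero (neg_ne_zero.2 Complex.I_ne_zero), Complex.log_I,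
        Complex.log_neg_I]
      have h1 : (Real.pi : ℂ) / 2 * Complex.I * (-(1 / 3)) =
        -((Real.pi / 6 : ℝ) : ℂ) * Complex.I := by push_cast; ring
      have h2 : -(Real.pi : ℂ) / 2 * Complex.I * (-(1 / 3)) =
        ((Real.pi / 6 : ℝ) : ℂ) * Complex.I := by push_cast; ring
      have h3 := Complex.two_cos ((Real.pi / 6 : ℝ) : ℂ)
      rw [← Complex.ofReal_cos, Real.cos_pi_div_six] at h3
      rw [h1, ← neg_div, h2, add_comm, ← h3]
      push_cast
      ring
    rw [e1, e2, ← mul_add, e3, Complex.ofReal_mul, Complex.ofReal_cpow ht.le]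
    push_cast
    ring
  rcases hs.lt_or_gt.symm with h | h
  · rw [abs_of_pos h, ← key s h, add_comm]
    simp
  · rw [abs_of_neg h, ← key (-s) (neg_pos.2 h)]
    simp

theorem sqrt_three_mul_Gamma_four_thirds :
    √3 * Real.Gamma (1 / 3 + 1) = 2 * Real.pi / (3 * Real.Gamma (2 / 3)) := by
  have h := Real.Gamma_mul_Gamma_one_sub (1 / 3)
  have hG : 0 < Real.Gamma (2 / 3) := Real.Gamma_pos_of_pos (by norm_num)
  rw [show (1 : ℝ) - 1 / 3 = 2 / 3 by norm_num, show Real.pi * (1 / 3) = Real.pi / 3 by ring,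
    Real.sin_pi_div_three] at h
  rw [Real.Gamma_add_one (by norm_num), eq_div_iff (by positivity)]
  have h3 : √3 * √3 = 3 := Real.mul_self_sqrt (by norm_num)
  have hs : 0 < √3 := by positivity
  calc √3 * (1 / 3 * Real.Gamma (1 / 3)) * (3 * Real.Gamma (2 / 3))
      = √3 * (Real.Gamma (1 / 3) * Real.Gamma (2 / 3)) := by ring
    _ = 2 * Real.pi := by rw [h]; field_simp

/-- The truncated Airy-type integral at the origin. -/
theorem norm_integral_cexp_I_mul_cube_sub_le' {s : ℝ} (hs : s ≠ 0) {A B : ℝ} (hA : A < 0)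
    (hB : 0 < B) :
    ‖(∫ u in A..B, Complex.exp (Complex.I * s * (u : ℂ) ^ 3)) -
      ((2 * Real.pi / (3 * Real.Gamma (2 / 3)) * |s| ^ (-(1 / 3) : ℝ) : ℝ) : ℂ)‖ ≤
      (1 / A ^ 2 + 1 / B ^ 2) / |s| := by
  have hc : Continuous fun u : ℝ => Complex.exp (Complex.I * s * (u : ℂ) ^ 3) := by fun_prop
  have h1 := norm_integral_cexp_I_mul_cube_sub_le hs hB
  have h2 := norm_integral_cexp_I_mul_cube_sub_le (neg_ne_zero.2 hs) (neg_pos.2 hA)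
  have hr : (∫ u in (0 : ℝ)..(-A), Complex.exp (Complex.I * (-s : ℝ) * (u : ℂ) ^ 3)) =
      ∫ u in A..0, Complex.exp (Complex.I * s * (u : ℂ) ^ 3) := by
    have := intervalIntegral.integral_comp_neg (a := 0) (b := -A)
      (fun u : ℝ => Complex.exp (Complex.I * s * (u : ℂ) ^ 3))
    rw [neg_neg, neg_zero] at this
    rw [← this]
    congr 1 with u
    push_cast
    ring_nf
  rw [hr, abs_neg, neg_sq] at h2
  rw [← intervalIntegral.integral_add_adjacent_intervals (hc.intervalIntegrable A 0)
    (hc.intervalIntegrable 0 B), ← sqrt_three_mul_Gamma_four_thirds]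
  have e : ((√3 * Real.Gamma (1 / 3 + 1) * |s| ^ (-(1 / 3) : ℝ) : ℝ) : ℂ) =
      Real.Gamma (1 / 3 + 1) * (-(Complex.I * (-s : ℝ))) ^ (-(1 / 3) : ℂ) +
      Real.Gamma (1 / 3 + 1) * (-(Complex.I * s)) ^ (-(1 / 3) : ℂ) := by
    rw [← mul_add, add_comm (_ ^ _), I_mul_cpow_add_neg_I_mul_cpow hs]
    push_cast
    ring
  rw [e, add_sub_add_comm]
  refine (norm_add_le _ _).trans ((add_le_add h2 h1).trans (le_of_eq ?_))
  have := abs_pos.2 hs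
  have hA' : A ≠ 0 := hA.ne
  field_simp

theorem hasDerivAt_integral_smul_comp_mul {E : Type*} [NormedAddCommGroup E] [NormedSpace ℝ E]
    {w : ℝ → ℝ} (hw : Continuous w) {g : ℝ → E} (hg : ContDiff ℝ 1 g) (z : ℝ) :
    HasDerivAt (fun z => ∫ t in (0 : ℝ)..1, w t • g (t * z))
      (∫ t in (0 : ℝ)..1, (w t * t) • deriv g (t * z)) z := by
  have hgc : Continuous g := hg.continuous
  have hg' : Continuous (deriv g) := hg.continuous_deriv le_rfl
  obtain ⟨M, hM⟩ := (isCompact_Icc (a := -(|z| + 1)) (b := |z| + 1)).exists_bound_of_continuousOn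
    hg'.continuousOn
  refine (intervalIntegral.hasDerivAt_integral_of_dominated_loc_of_deriv_le
    (F := fun z t => w t • g (t * z)) (F' := fun z t => (w t * t) • deriv g (t * z))
    (bound := fun t => |w t * t| * M) (Metric.ball_mem_nhds z one_pos)
    (Filter.Eventually.of_forall fun x => Continuous.aestronglyMeasurable (by fun_prop))
    (Continuous.intervalIntegrable (by fun_prop) _ _)
    (Continuous.aestronglyMeasurable (by fun_prop)) ?_
    (Continuous.intervalIntegrable (by fun_prop) _ _) ?_).2
  · refine Filter.Eventually.of_forall fun t ht x hx => ?_
    rw [Set.uIoc_of_le zero_le_one] at ht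
    rw [norm_smul, Real.norm_eq_abs]
    refine mul_le_mul_of_nonneg_left (hM _ ?_) (abs_nonneg _)
    have h1 : |x| ≤ |z| + 1 := by
      have := abs_sub_abs_le_abs_sub x z
      have hx' : |x - z| < 1 := by simpa [Real.dist_eq] using hx
      linarith
    rw [Set.mem_Icc, ← abs_le, abs_mul, abs_of_pos ht.1]
    exact (mul_le_of_le_one_left (abs_nonneg x) ht.2).trans h1
  · refine Filter.Eventually.of_forall fun t _ x _ => ?_
    have h := (hg.differentiable one_ne_zero (t * x)).hasDerivAt
    have h2 : HasDerivAt (fun x => t * x) t x := by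
      simpa using (hasDerivAt_id x).const_mul t
    have := (h.scomp x h2).const_smul (w t)
    rw [smul_smul] at this
    exact this

theorem contDiff_integral_smul_comp_mul {E : Type*} [NormedAddCommGroup E] [NormedSpace ℝ E]
    {w : ℝ → ℝ} (hw : Continuous w) {g : ℝ → E} (hg : ContDiff ℝ (⊤ : ℕ∞) g) :
    ContDiff ℝ (⊤ : ℕ∞) (fun z => ∫ t in (0 : ℝ)..1, w t • g (t * z)) := by
  rw [contDiff_infty]
  intro n
  induction n generalizing w g with
  | zero =>
    rw [Nat.cast_zero, contDiff_zero]
    have := hg.continuous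
    exact intervalIntegral.continuous_parametric_intervalIntegral_of_continuous' (by fun_prop) _ _
  | succ n ih =>
    have hd := hasDerivAt_integral_smul_comp_mul hw (hg.of_le (by exact_mod_cast le_top))
    push_cast
    refine contDiff_succ_iff_deriv.2 ⟨fun z => (hd z).differentiableAt, by simp, ?_⟩
    rw [funext fun z => (hd z).deriv]
    exact ih (hw.mul continuous_id) (contDiff_infty_iff_deriv.1 hg).2

/-- **Hadamard's lemma** on the line. -/
theorem exists_contDiff_eq_smul {E : Type*} [NormedAddCommGroup E] [NormedSpace ℝ E]
    [CompleteSpace E] {g : ℝ → E} (hg : ContDiff ℝ (⊤ : ℕ∞) g) (h0 : g 0 = 0) :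
    ∃ h : ℝ → E, ContDiff ℝ (⊤ : ℕ∞) h ∧ ∀ z, g z = z • h z := by
  have hg' := (contDiff_infty_iff_deriv.1 hg).2
  refine ⟨_, contDiff_integral_smul_comp_mul (w := fun _ => 1) continuous_const hg', fun z => ?_⟩
  have hc : Continuous fun t : ℝ => z • deriv g (t * z) := by
    have := hg'.continuous
    fun_prop
  have := intervalIntegral.integral_eq_sub_of_hasDerivAt (a := 0) (b := 1)
    (f := fun t : ℝ => g (t * z)) (f' := fun t => z • deriv g (t * z)) (fun t _ => by
      have h := ((contDiff_infty_iff_deriv.1 hg).1 (t * z)).hasDerivAt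
      have h2 : HasDerivAt (fun t => t * z) z t := by
        simpa using (hasDerivAt_id t).mul_const z
      exact h.scomp t h2) (hc.intervalIntegrable _ _)
  rw [intervalIntegral.integral_smul] at this
  simpa [h0] using this.symm

/-- A smooth function that does not vanish at the origin agrees near the origin with a smooth
function of constant sign. -/
theorem exists_contDiff_eventuallyEq_div_pos {k : ℝ → ℝ} (hk : ContDiff ℝ (⊤ : ℕ∞) k)
    (h0 : k 0 ≠ 0) :
    ∃ p : ℝ → ℝ, ContDiff ℝ (⊤ : ℕ∞) p ∧ (∀ z, 0 < p z / k 0) ∧ p =ᶠ[nhds 0] k := by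
  have hcont : ContinuousAt (fun z => k z / k 0) 0 := by
    have := hk.continuous
    fun_prop
  have hpos : ∀ᶠ z in nhds 0, 0 < k z / k 0 :=
    hcont.eventually_const_lt (by simp [h0])
  obtain ⟨r, hr, hball⟩ := Metric.eventually_nhds_iff_ball.1 hpos
  let χ : ContDiffBump (0 : ℝ) := ⟨r / 2, r, half_pos hr, half_lt_self hr⟩
  refine ⟨fun z => k 0 + χ z * (k z - k 0), contDiff_const.add
    (χ.contDiff.mul (hk.sub contDiff_const)), fun z => ?_, ?_⟩
  · have e : (k 0 + χ z * (k z - k 0)) / k 0 = (1 - χ z) + χ z * (k z / k 0) := by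
      field_simp
      ring
    rw [e]
    by_cases hz : z ∈ Metric.ball (0 : ℝ) r
    · have h1 := χ.nonneg' z
      have h2 := χ.le_one (x := z)
      have h3 := hball z hz
      rcases h1.eq_or_lt with h | h
      · rw [← h]; norm_num
      · have := mul_pos h h3
        linarith
    · have : χ z = 0 := χ.zero_of_le_dist (by simpa [χ] using hz)
      rw [this]; norm_num
  · filter_upwards [χ.eventuallyEq_one] with z hz
    rw [hz]
    simp

/-- Half-line van der Corput estimate for a phase with a cubic critical point at the left end and
an amplitude vanishing there. -/
theorem exists_norm_integral_mul_cexp_le {q : ℝ → ℂ} (hq : ContDiff ℝ 1 q) {k ψ : ℝ → ℝ}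
    (hk : Continuous k) (hψc : Continuous ψ) {δ : ℝ} (hδ : 0 < δ)
    (hψ : ∀ z ∈ Set.Icc 0 δ, HasDerivAt ψ (z ^ 2 * k z) z) :
    ∃ C : ℝ, 0 ≤ C ∧ ∀ ε ω : ℝ, 0 < ε → ε ≤ δ → ω * ε ^ 3 = 1 →
      ‖∫ z in (0 : ℝ)..δ, (z : ℂ) * k z * q z * Complex.exp (Complex.I * ω * ψ z)‖ ≤
        C * ε ^ 2 := by
  have hqc : Continuous q := hq.continuous
  have hq' : Continuous (deriv q) := hq.continuous_deriv le_rfl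
  obtain ⟨M, hM⟩ := (isCompact_Icc (a := 0) (b := δ)).exists_bound_of_continuousOn
    (f := fun z => ((q z, deriv q z), (k z : ℂ) * q z)) (by fun_prop)
  have hM1 : ∀ z ∈ Set.Icc 0 δ, ‖q z‖ ≤ M := fun z hz =>
    (norm_fst_le _).trans ((norm_fst_le _).trans (hM z hz))
  have hM2 : ∀ z ∈ Set.Icc 0 δ, ‖deriv q z‖ ≤ M := fun z hz =>
    (norm_snd_le _).trans ((norm_fst_le _).trans (hM z hz))
  have hM3 : ∀ z ∈ Set.Icc 0 δ, ‖(k z : ℂ) * q z‖ ≤ M := fun z hz =>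
    (norm_snd_le _).trans (hM z hz)
  have hM0 : 0 ≤ M := (norm_nonneg _).trans (hM1 0 ⟨le_rfl, hδ.le⟩)
  refine ⟨M + (M + M + M * (1 + δ)), by positivity, fun ε ω hε hεδ hω => ?_⟩
  have hω0 : 0 < ω := by
    have h3 : 0 < ε ^ 3 := by positivity
    by_contra h
    have := mul_nonpos_of_nonpos_of_nonneg (not_lt.1 h) h3.le
    linarith
  have hωC : (ω : ℂ) ≠ 0 := Complex.ofReal_ne_zero.2 hω0.ne'
  have hε2 : 1 / (ω * ε) = ε ^ 2 := by
    rw [div_eq_iff (by positivity), ← hω]; ring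
  set e : ℝ → ℂ := fun z => Complex.exp (Complex.I * ω * ψ z) with he
  have hec : Continuous e := by fun_prop
  have hen : ∀ z, ‖e z‖ = 1 := by
    intro z
    have : Complex.I * ω * ψ z = ((ω * ψ z : ℝ) : ℂ) * Complex.I := by push_cast; ring
    rw [he]
    simp only
    rw [this, Complex.norm_exp_ofReal_mul_I]
  have hFc : Continuous fun z : ℝ => (z : ℂ) * k z * q z * e z := by fun_prop
  rw [← intervalIntegral.integral_add_adjacent_intervals (hFc.intervalIntegrable 0 ε)
    (hFc.intervalIntegrable ε δ), add_mul]
  refine (norm_add_le _ _).trans (add_le_add ?_ ?_)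
  · have : ∀ z ∈ Set.uIoc 0 ε, ‖(z : ℂ) * k z * q z * e z‖ ≤ M * ε := by
      intro z hz
      rw [Set.uIoc_of_le hε.le] at hz
      rw [norm_mul, hen, mul_one, mul_assoc, norm_mul, Complex.norm_real,
        Real.norm_of_nonneg hz.1.le, mul_comm]
      exact mul_le_mul (hM3 z ⟨hz.1.le, hz.2.trans hεδ⟩) hz.2 hz.1.le hM0
    refine (intervalIntegral.norm_integral_le_of_norm_le_const this).trans (le_of_eq ?_)
    rw [sub_zero, abs_of_pos hε]
    ring
  · have hpos : ∀ z ∈ Set.uIcc ε δ, 0 < z ∧ z ≤ δ := by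
      intro z hz
      rw [Set.uIcc_of_le hεδ] at hz
      exact ⟨hε.trans_le hz.1, hz.2⟩
    set E : ℝ → ℂ := fun z => q z * e z / (Complex.I * ω * z) with hE
    set R : ℝ → ℂ := fun z => (deriv q z / z - q z / (z : ℂ) ^ 2) * e z / (Complex.I * ω) with hR
    have hEd : ∀ z ∈ Set.uIcc ε δ, HasDerivAt E (R z + (z : ℂ) * k z * q z * e z) z := by
      intro z hz
      obtain ⟨hz0, hz1⟩ := hpos z hz
      have hzC : (z : ℂ) ≠ 0 := Complex.ofReal_ne_zero.2 hz0.ne'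
      have d1 := (hq.differentiable one_ne_zero z).hasDerivAt
      have d2 : HasDerivAt e (e z * (Complex.I * ω * ((z ^ 2 * k z : ℝ) : ℂ))) z :=
        ((hψ z ⟨hz0.le, hz1⟩).ofReal_comp.const_mul (Complex.I * (ω : ℂ))).cexp
      have d3 : HasDerivAt (fun z : ℝ => Complex.I * ω * (z : ℂ)) (Complex.I * ω) z := by
        simpa using ((hasDerivAt_id (z : ℂ)).comp_ofReal).const_mul (Complex.I * (ω : ℂ))
      refine ((d1.mul d2).div d3 (by simp [hωC, hzC])).congr_deriv ?_
      simp only [hR, Pi.mul_apply]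
      have := Complex.I_ne_zero
      push_cast
      field_simp
      ring
    have hRc : ContinuousOn R (Set.uIcc ε δ) := by
      intro z hz
      have hzC : (z : ℂ) ≠ 0 := Complex.ofReal_ne_zero.2 (hpos z hz).1.ne'
      have hzC2 : (z : ℂ) ^ 2 ≠ 0 := pow_ne_zero 2 hzC
      have h3 : Complex.I * (ω : ℂ) ≠ 0 := mul_ne_zero Complex.I_ne_zero hωC
      rw [hR]
      fun_prop (disch := assumption)
    have hRi := hRc.intervalIntegrable (μ := volume)
    have hFTC := intervalIntegral.integral_eq_sub_of_hasDerivAt hEd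
      (hRi.add (hFc.intervalIntegrable ε δ))
    rw [intervalIntegral.integral_add hRi (hFc.intervalIntegrable ε δ), ← eq_sub_iff_add_eq'] at hFTC
    have hEb : ∀ z ∈ Set.uIcc ε δ, ‖E z‖ ≤ M * ε ^ 2 := by
      intro z hz
      obtain ⟨hz0, hz1⟩ := hpos z hz
      rw [Set.uIcc_of_le hεδ] at hz
      have : ‖Complex.I * ω * (z : ℂ)‖ = ω * z := by simp [abs_of_pos hω0, abs_of_pos hz0]
      rw [hE]
      simp only
      rw [norm_div, norm_mul, hen, mul_one, this, ← hε2, ← mul_one_div]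
      refine mul_le_mul (hM1 z ⟨hz0.le, hz1⟩) ?_ (by positivity) hM0
      exact one_div_le_one_div_of_le (by positivity) (mul_le_mul_of_nonneg_left hz.1 hω0.le)
    have hRn : ∀ z ∈ Set.Ioc ε δ, ‖R z‖ ≤ M * (1 + δ) / ω * z ^ (-2 : ℝ) := by
      intro z hz
      obtain ⟨hz0, hz1⟩ := hpos z (by rw [Set.uIcc_of_le hεδ]; exact ⟨hz.1.le, hz.2⟩)
      have hI : ‖Complex.I * (ω : ℂ)‖ = ω := by simp [abs_of_pos hω0]
      have h2 : z ^ (-2 : ℝ) = 1 / z ^ 2 := by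
        rw [Real.rpow_neg hz0.le, one_div]; norm_cast
      rw [hR]
      simp only
      rw [norm_div, norm_mul, hen, mul_one, hI, h2]
      have b1 : ‖deriv q z / z‖ ≤ M * δ / z ^ 2 := by
        rw [norm_div, Complex.norm_real, Real.norm_of_nonneg hz0.le,
          div_le_div_iff₀ hz0 (by positivity)]
        have := mul_le_mul (hM2 z ⟨hz0.le, hz1⟩) hz1 hz0.le hM0
        nlinarith
      have b2 : ‖q z / (z : ℂ) ^ 2‖ ≤ M / z ^ 2 := by
        rw [norm_div, norm_pow, Complex.norm_real, Real.norm_of_nonneg hz0.le]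
        gcongr
        exact hM1 z ⟨hz0.le, hz1⟩
      have b3 : ‖deriv q z / z - q z / (z : ℂ) ^ 2‖ ≤ M * (1 + δ) / z ^ 2 := by
        refine (norm_sub_le _ _).trans ((add_le_add b1 b2).trans (le_of_eq ?_))
        ring
      calc _ ≤ M * (1 + δ) / z ^ 2 / ω := by gcongr
        _ = _ := by field_simp
    have hz2c : ContinuousOn (fun z : ℝ => z ^ (-2 : ℝ)) (Set.uIcc ε δ) := fun z hz =>
      (Real.continuousAt_rpow_const z _ (Or.inl (hpos z hz).1.ne')).continuousWithinAt
    have hRb : ‖∫ z in ε..δ, R z‖ ≤ M * (1 + δ) * ε ^ 2 := by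
      refine (intervalIntegral.norm_integral_le_of_norm_le hεδ
        (Filter.Eventually.of_forall fun z hz => hRn z hz)
        (hz2c.intervalIntegrable.const_mul _)).trans ?_
      rw [intervalIntegral.integral_const_mul, integral_rpow (Or.inr ⟨by norm_num, fun h =>
        lt_irrefl _ (hpos 0 h).1⟩)]
      have h1 : ∀ x : ℝ, x ^ (-2 + 1 : ℝ) = 1 / x := fun x => by
        rw [show (-2 + 1 : ℝ) = -1 by norm_num, Real.rpow_neg_one, one_div]
      rw [h1, h1, ← hε2]
      have hδ' : 0 < 1 / δ := by positivity
      have h3 : (1 / δ - 1 / ε) / (-2 + 1) ≤ 1 / ε := by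
        rw [show (-2 + 1 : ℝ) = -1 by norm_num, div_neg, div_one]
        linarith
      calc _ ≤ M * (1 + δ) / ω * (1 / ε) := by gcongr
        _ = _ := by field_simp
    rw [hFTC]
    refine (norm_sub_le _ _).trans ?_
    rw [add_mul]
    refine add_le_add ((norm_sub_le _ _).trans ?_) hRb
    rw [add_mul]
    exact add_le_add (hEb δ Set.right_mem_uIcc) (hEb ε Set.left_mem_uIcc)

theorem exists_norm_integral_symm_mul_cexp_le {q : ℝ → ℂ} (hq : ContDiff ℝ 1 q) {k ψ : ℝ → ℝ}
    (hk : Continuous k) (hψc : Continuous ψ) {δ : ℝ} (hδ : 0 < δ)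
    (hψ : ∀ z ∈ Set.Icc (-δ) δ, HasDerivAt ψ (z ^ 2 * k z) z) :
    ∃ C : ℝ, 0 ≤ C ∧ ∀ ε ω : ℝ, 0 < ε → ε ≤ δ → ω * ε ^ 3 = 1 →
      ‖∫ z in (-δ)..δ, (z : ℂ) * k z * q z * Complex.exp (Complex.I * ω * ψ z)‖ ≤
        C * ε ^ 2 := by
  obtain ⟨C₁, hC₁, h1⟩ := exists_norm_integral_mul_cexp_le hq hk hψc hδ
    fun z hz => hψ z ⟨by linarith [hz.1], hz.2⟩
  obtain ⟨C₂, hC₂, h2⟩ := exists_norm_integral_mul_cexp_le (q := fun z => q (-z))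
    (k := fun z => -k (-z)) (ψ := fun z => ψ (-z)) (by fun_prop) (by fun_prop) (by fun_prop) hδ
    (fun z hz => by
      have := (hψ (-z) ⟨by linarith [hz.2], by linarith [hz.1, hδ]⟩).scomp z (hasDerivAt_neg z)
      refine this.congr_deriv ?_
      simp)
  refine ⟨C₂ + C₁, by positivity, fun ε ω hε hεδ hω => ?_⟩
  have hqc : Continuous q := hq.continuous
  have hc : Continuous fun z : ℝ =>
      (z : ℂ) * k z * q z * Complex.exp (Complex.I * ω * ψ z) := by fun_prop
  rw [← intervalIntegral.integral_add_adjacent_intervals (hc.intervalIntegrable (-δ) 0)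
    (hc.intervalIntegrable 0 δ), add_mul]
  refine (norm_add_le _ _).trans (add_le_add ?_ (h1 ε ω hε hεδ hω))
  have e := intervalIntegral.integral_comp_neg (a := 0) (b := δ) (fun z : ℝ =>
    (z : ℂ) * k z * q z * Complex.exp (Complex.I * ω * ψ z))
  rw [neg_zero] at e
  rw [← e]
  simpa using h2 ε ω hε hεδ hω

theorem iteratedDeriv_succ_id_mul {g : ℝ → ℝ} (hg : ContDiff ℝ (⊤ : ℕ∞) g) (n : ℕ) (z : ℝ) :
    iteratedDeriv (n + 1) (fun z => z * g z) z =
      z * iteratedDeriv (n + 1) g z + (n + 1) * iteratedDeriv n g z := by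
  have hd : ∀ m z, HasDerivAt (iteratedDeriv m g) (iteratedDeriv (m + 1) g z) z := fun m z => by
    rw [iteratedDeriv_succ]
    exact (hg.differentiable_iteratedDeriv m (by exact_mod_cast ENat.natCast_lt_top m) z).hasDerivAt
  induction n generalizing z with
  | zero =>
    have := (hasDerivAt_id z).mul (hd 0 z)
    rw [iteratedDeriv_zero] at this
    rw [zero_add, iteratedDeriv_one]
    refine this.deriv.trans ?_
    simp
    ring
  | succ n ih =>
    rw [iteratedDeriv_succ, funext ih]
    refine (((hasDerivAt_id z).mul (hd (n + 1) z)).add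
      ((hd n z).const_mul ((n : ℝ) + 1))).deriv.trans ?_
    simp
    ring

/-- Taylor's formula at a doubly degenerate critical point, with smooth cubic factor. -/
theorem exists_contDiff_eq_add_cube_mul {lam : ℝ → ℝ} (hlam : ContDiff ℝ (⊤ : ℕ∞) lam)
    (h1 : deriv lam 0 = 0) (h2 : iteratedDeriv 2 lam 0 = 0) :
    ∃ g : ℝ → ℝ, ContDiff ℝ (⊤ : ℕ∞) g ∧ (∀ z, lam z = lam 0 + z ^ 3 * g z) ∧
      iteratedDeriv 3 lam 0 = 6 * g 0 := by
  obtain ⟨g₁, hg₁, e₁⟩ := exists_contDiff_eq_smul (g := fun z => lam z - lam 0)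
    (hlam.sub contDiff_const) (sub_self _)
  have el : lam = fun z => lam 0 + z * g₁ z := by
    funext z
    rw [← smul_eq_mul, ← e₁]
    ring
  have hit : ∀ n : ℕ, iteratedDeriv (n + 1) lam 0 = (n + 1) * iteratedDeriv n g₁ 0 := by
    intro n
    conv_lhs => rw [el]
    rw [iteratedDeriv_const_add n.succ_pos, iteratedDeriv_succ_id_mul hg₁, zero_mul, zero_add]
  have hz₁ : g₁ 0 = 0 := by
    have := hit 0
    rw [zero_add, iteratedDeriv_one, h1] at this
    simpa using this.symm
  obtain ⟨g₂, hg₂, e₂⟩ := exists_contDiff_eq_smul hg₁ hz₁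
  have hit₂ : ∀ n : ℕ, iteratedDeriv (n + 1) g₁ 0 = (n + 1) * iteratedDeriv n g₂ 0 := by
    intro n
    rw [show g₁ = fun z => z * g₂ z from funext e₂, iteratedDeriv_succ_id_mul hg₂, zero_mul,
      zero_add]
  have hz₂ : g₂ 0 = 0 := by
    have := hit 1
    rw [h2, hit₂ 0] at this
    simpa using this.symm
  obtain ⟨g₃, hg₃, e₃⟩ := exists_contDiff_eq_smul hg₂ hz₂
  refine ⟨g₃, hg₃, fun z => ?_, ?_⟩
  · have := congrFun el z
    rw [this, e₂, e₃]
    simp only [smul_eq_mul]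
    ring
  · rw [hit 2, hit₂ 1, show g₂ = fun z => z * g₃ z from funext e₃, iteratedDeriv_succ_id_mul hg₃,
      iteratedDeriv_zero]
    push_cast
    ring

theorem airy_constant_eq {c ω : ℝ} (hc : c ≠ 0) (hω : 0 < ω) :
    2 * Real.pi * (1 / ((3 : ℝ) ^ ((2 : ℝ) / 3) * Real.Gamma (2 / 3))) *
      (2 / |6 * c|) ^ ((1 : ℝ) / 3) * ω ^ (-(1 / 3 : ℝ)) =
    2 * Real.pi / (3 * Real.Gamma (2 / 3)) * |ω * c| ^ (-(1 / 3) : ℝ) := by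
  have hc' : 0 < |c| := abs_pos.2 hc
  have hG : 0 < Real.Gamma (2 / 3) := Real.Gamma_pos_of_pos (by norm_num)
  have e1 : 2 / |6 * c| = (3 * |c|)⁻¹ := by
    rw [abs_mul, abs_of_pos (by norm_num : (0 : ℝ) < 6)]
    field_simp
    norm_num
  have h3 : (3 : ℝ) ^ ((2 : ℝ) / 3) * 3 ^ ((1 : ℝ) / 3) = 3 := by
    rw [← Real.rpow_add (by norm_num)]; norm_num
  rw [e1, abs_mul, abs_of_pos hω, Real.mul_rpow hω.le hc'.le, Real.inv_rpow (by positivity),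
    Real.mul_rpow (by norm_num) hc'.le, Real.rpow_neg hc'.le]
  have p1 : 0 < (3 : ℝ) ^ ((2 : ℝ) / 3) := by positivity
  have p2 : 0 < (3 : ℝ) ^ ((1 : ℝ) / 3) := by positivity
  have p3 : 0 < |c| ^ ((1 : ℝ) / 3) := by positivity
  field_simp
  rw [h3]

/-- A phase `c φ ^ 3` with `φ` a smooth local coordinate. -/
theorem exists_norm_integral_mul_cexp_cube_sub_le {p : ℝ → ℝ} (hp : ContDiff ℝ (⊤ : ℕ∞) p)
    (hpos : ∀ z, 0 < p z / p 0) :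
    ∃ δ₀ > 0, ∀ δ > 0, δ < δ₀ → ∀ f : ℝ → ℂ, ContDiff ℝ (⊤ : ℕ∞) f →
      ∃ C : ℝ, 0 < C ∧ ∃ ω₀ > 0, ∀ ω : ℝ, ω₀ ≤ ω →
        ‖(∫ z in (-δ)..δ, f z * Complex.exp (Complex.I * ω * ((z ^ 3 * p z : ℝ) : ℂ))) -
          f 0 * ((2 * Real.pi / (3 * Real.Gamma (2 / 3)) * |ω * p 0| ^ (-(1 / 3) : ℝ) : ℝ) : ℂ)‖ ≤
        C * ω ^ (-(2 / 3 : ℝ)) := by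
  have hc : p 0 ≠ 0 := by
    intro h
    simpa [h] using hpos 0
  set c := p 0 with hcdef
  set a : ℝ → ℝ := fun z => (p z / c) ^ ((1 : ℝ) / 3) with ha
  have hac : ContDiff ℝ (⊤ : ℕ∞) a :=
    (hp.div_const c).rpow_const_of_ne fun z => (hpos z).ne'
  have hapos : ∀ z, 0 < a z := fun z => Real.rpow_pos_of_pos (hpos z) _
  have ha0 : a 0 = 1 := by simp [ha, ← hcdef, hc]
  have ha3 : ∀ z, a z ^ 3 = p z / c := fun z => by
    rw [ha, ← Real.rpow_natCast, ← Real.rpow_mul (hpos z).le]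
    norm_num
  set φ : ℝ → ℝ := fun z => z * a z with hφ
  have hφc : ContDiff ℝ (⊤ : ℕ∞) φ := contDiff_id.mul hac
  have hφ' : ContDiff ℝ (⊤ : ℕ∞) (deriv φ) := (contDiff_infty_iff_deriv.1 hφc).2
  have hφd : ∀ z, HasDerivAt φ (deriv φ z) z := fun z =>
    ((contDiff_infty_iff_deriv.1 hφc).1 z).hasDerivAt
  have hφ'0 : deriv φ 0 = 1 := by
    have := ((hasDerivAt_id (0 : ℝ)).mul ((contDiff_infty_iff_deriv.1 hac).1 0).hasDerivAt).deriv
    refine Eq.trans this ?_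
    simp [ha0]
  have hφ3 : ∀ z, z ^ 3 * p z = c * φ z ^ 3 := fun z => by
    rw [hφ]
    simp only
    rw [mul_pow, ha3]
    field_simp
  have hp' := contDiff_infty_iff_deriv.1 hp
  obtain ⟨k, hk, hkpos, hkeq⟩ := exists_contDiff_eventuallyEq_div_pos
    (k := fun z => 3 * p z + z * deriv p z)
    ((contDiff_const.mul hp).add (contDiff_id.mul hp'.2)) (by simpa [← hcdef] using hc)
  have hk0 : ∀ z, k z ≠ 0 := fun z h => by
    have := hkpos z
    simp [h] at this
  obtain ⟨δ₀, hδ₀, hball⟩ := Metric.eventually_nhds_iff_ball.1 hkeq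
  refine ⟨δ₀, hδ₀, fun δ hδ hδδ₀ f hf => ?_⟩
  obtain ⟨h, hh, hG⟩ := exists_contDiff_eq_smul
    (g := fun z => f z - f 0 * ((deriv φ z : ℝ) : ℂ))
    (hf.sub (contDiff_const.mul (Complex.ofRealCLM.contDiff.comp hφ'))) (by simp [hφ'0])
  have hkC : ContDiff ℝ (⊤ : ℕ∞) fun z => (k z : ℂ) := Complex.ofRealCLM.contDiff.comp hk
  have hq : ContDiff ℝ (⊤ : ℕ∞) fun z => h z / (k z : ℂ) := by
    simp only [div_eq_mul_inv]
    exact hh.mul (hkC.inv fun z => Complex.ofReal_ne_zero.2 (hk0 z))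
  have hpc : Continuous p := hp.continuous
  obtain ⟨C, hC, hrem⟩ := exists_norm_integral_symm_mul_cexp_le
    (hq.of_le (by exact_mod_cast le_top)) hk.continuous (ψ := fun z => z ^ 3 * p z)
    (by fun_prop) hδ (fun z hz => by
      have hz' : z ∈ Metric.ball (0 : ℝ) δ₀ := by
        rw [mem_ball_zero_iff, Real.norm_eq_abs]
        exact (abs_le.2 hz).trans_lt hδδ₀
      rw [hball z hz']
      refine ((hasDerivAt_pow 3 z).mul (hp'.1 z).hasDerivAt).congr_deriv ?_
      push_cast
      ring)
  have hA : φ (-δ) < 0 := mul_neg_of_neg_of_pos (neg_neg_of_pos hδ) (hapos _)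
  have hB : 0 < φ δ := mul_pos hδ (hapos _)
  have hcpos := abs_pos.2 hc
  set D : ℝ := (1 / φ (-δ) ^ 2 + 1 / φ δ ^ 2) / |c| with hD
  have hD0 : 0 ≤ D := by positivity
  refine ⟨‖f 0‖ * D + C + 1, by positivity, max 1 (δ ^ (-3 : ℝ)), by positivity,
    fun ω hω => ?_⟩
  have hω1 : 1 ≤ ω := (le_max_left _ _).trans hω
  have hω0 : 0 < ω := by linarith
  set ε : ℝ := ω ^ (-(1 / 3) : ℝ) with hε
  have hε0 : 0 < ε := Real.rpow_pos_of_pos hω0 _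
  have hεδ : ε ≤ δ := by
    have h1 : ω ^ (-(1 / 3) : ℝ) ≤ (δ ^ (-3 : ℝ)) ^ (-(1 / 3) : ℝ) :=
      Real.rpow_le_rpow_of_nonpos (by positivity) ((le_max_right _ _).trans hω) (by norm_num)
    rw [← Real.rpow_mul hδ.le] at h1
    norm_num at h1
    simpa [hε] using h1
  have hε3 : ω * ε ^ 3 = 1 := by
    rw [hε, ← Real.rpow_natCast, ← Real.rpow_mul hω0.le]
    norm_num
    rw [Real.rpow_neg_one]
    field_simp
  have hε2 : ε ^ 2 = ω ^ (-(2 / 3) : ℝ) := by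
    rw [hε, ← Real.rpow_natCast, ← Real.rpow_mul hω0.le]
    norm_num
  have hrem' := hrem ε ω hε0 hεδ hε3
  rw [hε2] at hrem'
  have hmodel := norm_integral_cexp_I_mul_cube_sub_le' (mul_ne_zero hω0.ne' hc) hA hB
  set J := ∫ u in φ (-δ)..φ δ, Complex.exp (Complex.I * (ω * c : ℝ) * (u : ℂ) ^ 3) with hJ
  have hsub : ∫ z in (-δ)..δ, ((deriv φ z : ℝ) : ℂ) *
      Complex.exp (Complex.I * ω * ((z ^ 3 * p z : ℝ) : ℂ)) = J := by
    rw [hJ, ← intervalIntegral.integral_deriv_smul_comp (f := φ) (f' := deriv φ)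
      (fun z _ => hφd z) hφ'.continuous.continuousOn (by fun_prop)]
    refine intervalIntegral.integral_congr fun z _ => ?_
    simp only [Function.comp_apply, Complex.real_smul, hφ3]
    push_cast
    ring_nf
  have hφ'c : Continuous (deriv φ) := hφ'.continuous
  have hhc : Continuous h := hh.continuous
  have hkc : Continuous k := hk.continuous
  have hqc : Continuous fun z => h z / (k z : ℂ) := hq.continuous
  have hi1 : Continuous fun z => f 0 * (((deriv φ z : ℝ) : ℂ) *
      Complex.exp (Complex.I * ω * ((z ^ 3 * p z : ℝ) : ℂ))) := by fun_prop
  have hi2 : Continuous fun z : ℝ => (z : ℂ) * k z * (h z / (k z : ℂ)) *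
      Complex.exp (Complex.I * ω * ((z ^ 3 * p z : ℝ) : ℂ)) := by fun_prop
  have hsplit : ∫ z in (-δ)..δ, f z * Complex.exp (Complex.I * ω * ((z ^ 3 * p z : ℝ) : ℂ)) =
      f 0 * J + ∫ z in (-δ)..δ, (z : ℂ) * k z * (h z / (k z : ℂ)) *
        Complex.exp (Complex.I * ω * ((z ^ 3 * p z : ℝ) : ℂ)) := by
    rw [← hsub, ← intervalIntegral.integral_const_mul, ← intervalIntegral.integral_add
      (hi1.intervalIntegrable _ _) (hi2.intervalIntegrable _ _)]
    refine intervalIntegral.integral_congr fun z _ => ?_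
    have hfz : f z = f 0 * ((deriv φ z : ℝ) : ℂ) + z * h z := by
      rw [← Complex.real_smul, ← hG]
      ring
    have hkz : (k z : ℂ) ≠ 0 := Complex.ofReal_ne_zero.2 (hk0 z)
    simp only [hfz]
    field_simp
  have hωle : ω⁻¹ ≤ ω ^ (-(2 / 3) : ℝ) := by
    rw [← Real.rpow_neg_one]
    exact Real.rpow_le_rpow_of_exponent_le hω1 (by norm_num)
  rw [hsplit, add_sub_right_comm, ← mul_sub]
  have hfirst : ‖f 0 * (J - ((2 * Real.pi / (3 * Real.Gamma (2 / 3)) *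
      |ω * c| ^ (-(1 / 3) : ℝ) : ℝ) : ℂ))‖ ≤ ‖f 0‖ * D * ω ^ (-(2 / 3) : ℝ) := by
    rw [norm_mul, mul_assoc]
    refine mul_le_mul_of_nonneg_left (hmodel.trans ?_) (norm_nonneg _)
    calc _ = D * ω⁻¹ := by
          rw [abs_mul, abs_of_pos hω0, hD]
          field_simp
      _ ≤ _ := mul_le_mul_of_nonneg_left hωle hD0
  have : 0 ≤ ω ^ (-(2 / 3) : ℝ) := by positivity
  refine (norm_add_le _ _).trans ((add_le_add hfirst hrem').trans ?_)
  linarith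

theorem stationary_phase_cubic (lam : ℝ → ℝ) (hlam : ContDiff ℝ (⊤ : ℕ∞) lam)
    (h1 : deriv lam 0 = 0) (h2 : iteratedDeriv 2 lam 0 = 0)
    (h3 : iteratedDeriv 3 lam 0 ≠ 0) :
    ∃ δ > 0, ∀ f : ℝ → ℂ, ContDiff ℝ (⊤ : ℕ∞) f → HasCompactSupport f →
      Function.support f ⊆ Set.Ioo (-δ) δ →
      ∃ C > 0, ∃ ω₀ > 0, ∀ ω : ℝ, ω₀ ≤ ω →
        ‖(∫ z : ℝ, f z * Complex.exp (Complex.I * ω * lam z)) -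
            ((2 * Real.pi : ℝ) : ℂ) * Complex.exp (Complex.I * (lam 0) * ω) *
              ((1 / ((3 : ℝ) ^ ((2 : ℝ) / 3) * Real.Gamma (2 / 3)) : ℝ) : ℂ) * f 0 *
              (((2 / |iteratedDeriv 3 lam 0|) ^ ((1 : ℝ) / 3) : ℝ) : ℂ) *
              ((ω ^ (-(1 / 3 : ℝ)) : ℝ) : ℂ)‖
          ≤ C * ω ^ (-(2 / 3 : ℝ)) := by
  obtain ⟨g, hg, hlg, hg3⟩ := exists_contDiff_eq_add_cube_mul hlam h1 h2
  have hg0 : g 0 ≠ 0 := by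
    intro h
    rw [hg3, h, mul_zero] at h3
    exact h3 rfl
  obtain ⟨p, hp, hpos, heq⟩ := exists_contDiff_eventuallyEq_div_pos hg hg0
  have hp0 : p 0 = g 0 := heq.self_of_nhds
  obtain ⟨δ₁, hδ₁, H⟩ := exists_norm_integral_mul_cexp_cube_sub_le hp (by rwa [hp0])
  obtain ⟨δ₂, hδ₂, hball⟩ := Metric.eventually_nhds_iff_ball.1 heq
  have hδ : 0 < min δ₁ δ₂ / 2 := by positivity
  have hδ1 : min δ₁ δ₂ / 2 < δ₁ := (half_lt_self (by positivity)).trans_le (min_le_left _ _)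
  have hδ2 : min δ₁ δ₂ / 2 < δ₂ := (half_lt_self (by positivity)).trans_le (min_le_right _ _)
  refine ⟨min δ₁ δ₂ / 2, hδ, fun f hf _ hsupp => ?_⟩
  set δ := min δ₁ δ₂ / 2
  obtain ⟨C, hC, ω₀, hω₀, hbound⟩ := H δ hδ hδ1 f hf
  refine ⟨C, hC, ω₀, hω₀, fun ω hω => ?_⟩
  have hωpos : 0 < ω := lt_of_lt_of_le hω₀ hω
  have hint : ∫ z : ℝ, f z * Complex.exp (Complex.I * ω * lam z) =
      Complex.exp (Complex.I * (lam 0) * ω) *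
        ∫ z in (-δ)..δ, f z * Complex.exp (Complex.I * ω * ((z ^ 3 * p z : ℝ) : ℂ)) := by
    rw [← intervalIntegral.integral_eq_integral_of_support_subset (a := -δ) (b := δ)
      ((Function.support_mul_subset_left _ _).trans (hsupp.trans Set.Ioo_subset_Ioc_self)),
      ← intervalIntegral.integral_const_mul]
    refine intervalIntegral.integral_congr fun z hz => ?_
    rw [Set.uIcc_of_le (by linarith)] at hz
    have hz' : z ∈ Metric.ball (0 : ℝ) δ₂ := by
      rw [mem_ball_zero_iff, Real.norm_eq_abs]
      exact (abs_le.2 hz).trans_lt hδ2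
    rw [hlg z, hball z hz', mul_left_comm, ← Complex.exp_add]
    push_cast
    ring_nf
  have hmain : ((2 * Real.pi : ℝ) : ℂ) * Complex.exp (Complex.I * (lam 0) * ω) *
      ((1 / ((3 : ℝ) ^ ((2 : ℝ) / 3) * Real.Gamma (2 / 3)) : ℝ) : ℂ) * f 0 *
      (((2 / |iteratedDeriv 3 lam 0|) ^ ((1 : ℝ) / 3) : ℝ) : ℂ) *
      ((ω ^ (-(1 / 3 : ℝ)) : ℝ) : ℂ) = Complex.exp (Complex.I * (lam 0) * ω) * (f 0 *
      ((2 * Real.pi / (3 * Real.Gamma (2 / 3)) * |ω * p 0| ^ (-(1 / 3) : ℝ) : ℝ) : ℂ)) := by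
    rw [hp0, ← airy_constant_eq hg0 hωpos, hg3]
    simp only [Complex.ofReal_mul]
    ring
  have hnorm : ‖Complex.exp (Complex.I * (lam 0) * ω)‖ = 1 := by
    rw [show Complex.I * (lam 0 : ℂ) * ω = ((lam 0 * ω : ℝ) : ℂ) * Complex.I by push_cast; ring,
      Complex.norm_exp_ofReal_mul_I]
  rw [hint, hmain, ← mul_sub, norm_mul, hnorm, one_mul]
  exact hbound ω hω

end
end

section
/- Let λ:ℝ→ℝ be smooth with λ'(0)=λ''(0)=λ'''(0)=λ⁗(0)=0 and λ⁽⁵⁾(0)≠0. Then there exists δ>0 (depending on λ) such that for every smooth compactly supported f:ℝ→ℂ with supp f ⊂ (−δ,δ), there exist C>0 and ω₀>0 with | ∫_ℝ f(z)·e^{iωλ(z)}·dz − e^{iλ(0)ω}·(2/5)·Γ(1/5)·sin(2π/5)·(120/|λ⁽⁵⁾(0)|)^{1/5}·f(0)·ω^{−1/5} | ≤ C·ω^{−2/5} for all ω ≥ ω₀. -/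
open MeasureTheory

noncomputable section

theorem norm_sub_le_of_hasDerivAt_exp_I_mul_pow_five {P : ℂ → ℂ}
    (hP : ∀ z, HasDerivAt P (Complex.exp (Complex.I * z ^ 5)) z) {u : ℝ} (hu : 1 ≤ u) :
    ‖P (u * Complex.exp (Complex.I * (Real.pi / 10 : ℝ))) - P u‖ ≤ 1 / (1 + u ^ 2) := by
  have hpi := Real.pi_pos
  have hu0 : 0 < u := by linarith
  set k : ℝ := 10 * u ^ 5 / Real.pi with hk
  have hk0 : 0 < k := by positivity
  have hF : ∀ θ : ℝ, HasDerivAt (fun θ : ℝ => P (u * Complex.exp (Complex.I * θ)))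
      (Complex.exp (Complex.I * (u * Complex.exp (Complex.I * θ)) ^ 5) *
        (u * (Complex.exp (Complex.I * θ) * Complex.I))) θ := by
    intro θ
    have h1 : HasDerivAt (fun θ : ℝ => (u : ℂ) * Complex.exp (Complex.I * θ))
        (u * (Complex.exp (Complex.I * θ) * Complex.I)) θ := by
      have h2 : HasDerivAt (fun θ : ℝ => Complex.I * (θ : ℂ)) Complex.I θ := by
        simpa using (Complex.ofRealCLM.hasDerivAt (x := θ)).const_mul Complex.I
      exact h2.cexp.const_mul _
    exact (hP _).comp θ h1
  have hint := intervalIntegral.integral_eq_sub_of_hasDerivAt (a := 0) (b := Real.pi / 10)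
    (fun θ _ => hF θ) (Continuous.intervalIntegrable (by fun_prop) _ _)
  have hG : ∀ θ : ℝ, HasDerivAt (fun θ : ℝ => -(u / k) * Real.exp (-k * θ))
      (u * Real.exp (-k * θ)) θ := by
    intro θ
    have h2 : HasDerivAt (fun θ : ℝ => -k * θ) (-k) θ := by
      simpa using (hasDerivAt_id θ).const_mul (-k)
    convert! h2.exp.const_mul (-(u / k)) using 1
    field_simp
  have hGint := intervalIntegral.integral_eq_sub_of_hasDerivAt (a := 0) (b := Real.pi / 10)
    (fun θ _ => hG θ) (Continuous.intervalIntegrable (by fun_prop) _ _)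
  have hle := intervalIntegral.norm_integral_le_of_norm_le (μ := volume) (a := 0)
    (b := Real.pi / 10)
    (f := fun θ : ℝ => Complex.exp (Complex.I * (u * Complex.exp (Complex.I * θ)) ^ 5) *
        (u * (Complex.exp (Complex.I * θ) * Complex.I)))
    (g := fun θ => u * Real.exp (-k * θ)) (by positivity)
    (Filter.Eventually.of_forall fun θ hθ => by
      have e1 : Complex.I * (u * Complex.exp (Complex.I * θ)) ^ 5 =
          Complex.I * ((u ^ 5 : ℝ) * Complex.exp ((5 * θ : ℝ) * Complex.I)) := by
        rw [mul_pow, ← Complex.exp_nat_mul]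
        push_cast
        ring_nf
      have e2 : ‖Complex.exp (Complex.I * (u * Complex.exp (Complex.I * θ)) ^ 5)‖ =
          Real.exp (-(u ^ 5 * Real.sin (5 * θ))) := by
        rw [Complex.norm_exp, e1]
        congr 1
        rw [Complex.I_mul_re, Complex.im_ofReal_mul, Complex.exp_ofReal_mul_I_im]
      have e3 : ‖Complex.exp (Complex.I * θ)‖ = 1 := by
        rw [mul_comm]
        exact Complex.norm_exp_ofReal_mul_I θ
      rw [norm_mul, e2, norm_mul, norm_mul, e3, Complex.norm_I, Complex.norm_real,
        Real.norm_of_nonneg hu0.le, mul_comm]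
      simp only [mul_one]
      gcongr
      have h5 := Real.mul_le_sin (x := 5 * θ) (by linarith [hθ.1]) (by linarith [hθ.2])
      have : k * θ = u ^ 5 * (2 / Real.pi * (5 * θ)) := by
        rw [hk]; ring
      nlinarith [pow_pos hu0 5])
    (Continuous.intervalIntegrable (by fun_prop) _ _)
  rw [hint, hGint] at hle
  simp only [Complex.ofReal_zero, mul_zero, Complex.exp_zero, mul_one, Real.exp_zero] at hle
  refine hle.trans ?_
  have h1 : -(u / k) * Real.exp (-k * (Real.pi / 10)) - -(u / k) ≤ u / k := by
    have : 0 < u / k * Real.exp (-k * (Real.pi / 10)) := by positivity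
    linarith
  refine h1.trans ?_
  rw [div_le_div_iff₀ hk0 (by positivity), one_mul, hk, le_div_iff₀ hpi]
  have hpi4 := Real.pi_lt_four
  have h2 : 1 ≤ u ^ 2 := one_le_pow₀ hu
  have h3 : u * (1 + u ^ 2) ≤ 2 * u ^ 5 := by nlinarith [mul_nonneg hu0.le (sub_nonneg.2 h2), mul_nonneg (pow_pos hu0 3).le (sub_nonneg.2 h2)]
  nlinarith [mul_pos hu0 (by positivity : 0 < 1 + u ^ 2), pow_pos hu0 5]

theorem norm_Gamma_sub_integral_exp_neg_pow_five_le {u : ℝ} (hu : 1 ≤ u) :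
    ‖Real.Gamma (6 / 5) - ∫ s in (0 : ℝ)..u, Real.exp (-s ^ 5)‖ ≤ 2 / (1 + u ^ 2) := by
  have hu0 : 0 < u := by linarith
  have hG : ∫ s in Set.Ioi (0 : ℝ), Real.exp (-s ^ 5) = Real.Gamma (6 / 5) := by
    have := integral_exp_neg_rpow (p := 5) (by norm_num)
    norm_num at this
    exact this
  have hI0 : IntegrableOn (fun s : ℝ => Real.exp (-s ^ 5)) (Set.Ioi 0) := by
    by_contra h
    rw [integral_undef h] at hG
    exact (Real.Gamma_pos_of_pos (by norm_num : (0 : ℝ) < 6 / 5)).ne hG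
  have hI : IntegrableOn (fun s : ℝ => Real.exp (-s ^ 5)) (Set.Ioi u) :=
    hI0.mono_set (Set.Ioi_subset_Ioi hu0.le)
  have hsub := intervalIntegral.integral_Ioi_sub_Ioi hI0 hu0.le
  rw [← hG, ← hsub, sub_sub_cancel, Real.norm_of_nonneg (integral_nonneg fun _ => (Real.exp_pos _).le)]
  calc ∫ s in Set.Ioi u, Real.exp (-s ^ 5) ≤ ∫ s in Set.Ioi u, Real.exp (-s) := by
        refine setIntegral_mono_on hI (integrableOn_exp_neg_Ioi u) measurableSet_Ioi
          fun s hs => ?_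
        have hs1 : 1 ≤ s := hu.trans (le_of_lt hs)
        gcongr
        exact le_self_pow₀ hs1 (by norm_num)
    _ = Real.exp (-u) := integral_exp_neg_Ioi u
    _ ≤ 2 / (1 + u ^ 2) := by
        rw [Real.exp_neg, ← one_div, div_le_div_iff₀ (Real.exp_pos u) (by positivity)]
        nlinarith [Real.quadratic_le_exp_of_nonneg hu0.le]

/-- The limit of the oscillatory integral `∫ s in 0..u, exp (i s⁵)` as `u → ∞`. -/
def quinticFresnel : ℂ :=
  Complex.exp (Complex.I * (Real.pi / 10 : ℝ)) * (Real.Gamma (6 / 5) : ℝ)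

theorem norm_quinticFresnel_sub_integral_le {u : ℝ} (hu : 1 ≤ u) :
    ‖quinticFresnel - ∫ s in (0 : ℝ)..u, Complex.exp (Complex.I * s ^ 5)‖ ≤ 3 / (1 + u ^ 2) := by
  obtain ⟨P, hP⟩ : Complex.IsExactOn (fun z : ℂ => Complex.exp (Complex.I * z ^ 5)) Set.univ :=
    Differentiable.isExactOn_univ (by fun_prop)
  replace hP : ∀ z, HasDerivAt P (Complex.exp (Complex.I * z ^ 5)) z := fun z => hP z trivial
  have h1 := intervalIntegral.integral_eq_sub_of_hasDerivAt (a := 0) (b := u)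
    (fun s _ => (hP (s : ℝ)).comp_ofReal) (Continuous.intervalIntegrable (by fun_prop) _ _)
  set w : ℂ := Complex.exp (Complex.I * (Real.pi / 10 : ℝ)) with hw
  have hw5 : w ^ 5 = Complex.I := by
    rw [hw, ← Complex.exp_nat_mul]
    refine Eq.trans ?_ Complex.exp_pi_div_two_mul_I
    congr 1
    push_cast
    ring
  have hder : ∀ s : ℝ, HasDerivAt (fun s : ℝ => P (s * w))
      (((Real.exp (-s ^ 5) : ℝ) : ℂ) * w) s := by
    intro s
    have h2 : HasDerivAt (fun s : ℝ => (s : ℂ) * w) w s := by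
      simpa using (Complex.ofRealCLM.hasDerivAt (x := s)).mul_const w
    have h3 := (hP (s * w)).comp s h2
    convert! h3 using 2
    rw [mul_pow, hw5]
    push_cast
    congr 1
    linear_combination (-(s : ℂ) ^ 5) * Complex.I_mul_I
  have h2 := intervalIntegral.integral_eq_sub_of_hasDerivAt (a := 0) (b := u)
    (fun s _ => hder s) (Continuous.intervalIntegrable (by fun_prop) _ _)
  rw [intervalIntegral.integral_mul_const, intervalIntegral.integral_ofReal] at h2
  have h3 := norm_sub_le_of_hasDerivAt_exp_I_mul_pow_five hP hu
  have h4 := norm_Gamma_sub_integral_exp_neg_pow_five_le hu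
  have hwn : ‖w‖ = 1 := by
    rw [hw, mul_comm]
    exact Complex.norm_exp_ofReal_mul_I _
  have key : quinticFresnel - ∫ s in (0 : ℝ)..u, Complex.exp (Complex.I * s ^ 5) =
      w * ((Real.Gamma (6 / 5) - ∫ s in (0 : ℝ)..u, Real.exp (-s ^ 5) : ℝ) : ℂ) +
        (P (u * w) - P u) := by
    rw [h1, quinticFresnel, ← hw]
    push_cast
    simp only [Complex.ofReal_zero, zero_mul] at h2 ⊢
    linear_combination h2
  rw [key]
  refine (norm_add_le _ _).trans ?_
  rw [norm_mul, hwn, one_mul, Complex.norm_real]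
  calc _ ≤ 2 / (1 + u ^ 2) + 1 / (1 + u ^ 2) := add_le_add h4 h3
    _ = _ := by ring

theorem exists_norm_quinticFresnel_sub_integral_le :
    ∃ K : ℝ, ∀ u : ℝ, 0 ≤ u →
      ‖quinticFresnel - ∫ s in (0 : ℝ)..u, Complex.exp (Complex.I * s ^ 5)‖ ≤ K / (1 + u ^ 2) := by
  refine ⟨2 * (‖quinticFresnel‖ + 1) + 3, fun u hu => ?_⟩
  rcases le_total 1 u with h | h
  · refine (norm_quinticFresnel_sub_integral_le h).trans ?_
    gcongr
    linarith [norm_nonneg quinticFresnel]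
  · have h1 : ‖∫ s in (0 : ℝ)..u, Complex.exp (Complex.I * s ^ 5)‖ ≤ 1 * |u - 0| :=
      intervalIntegral.norm_integral_le_of_norm_le_const fun s _ => by
        rw [mul_comm]
        exact_mod_cast (Complex.norm_exp_ofReal_mul_I (s ^ (5 : ℕ))).le
    rw [sub_zero, abs_of_nonneg hu] at h1
    rw [le_div_iff₀ (by positivity)]
    have h2 := norm_sub_le quinticFresnel (∫ s in (0 : ℝ)..u, Complex.exp (Complex.I * s ^ 5))
    have h3 : 1 + u ^ 2 ≤ 2 := by nlinarith
    calc _ ≤ (‖quinticFresnel‖ + 1) * 2 :=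
          mul_le_mul (by linarith) h3 (by positivity) (by positivity)
      _ ≤ _ := by linarith

theorem quinticFresnel_add_conj :
    quinticFresnel + starRingEnd ℂ quinticFresnel =
      ((2 / 5 : ℝ) * Real.Gamma (1 / 5) * Real.sin (2 * Real.pi / 5) : ℝ) := by
  have hre : quinticFresnel.re = Real.cos (Real.pi / 10) * Real.Gamma (6 / 5) := by
    rw [quinticFresnel, Complex.re_mul_ofReal, mul_comm Complex.I, Complex.exp_ofReal_mul_I_re]
  have hG : Real.Gamma (6 / 5) = 1 / 5 * Real.Gamma (1 / 5) := by
    rw [← Real.Gamma_add_one (by norm_num)]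
    norm_num
  have hs : Real.sin (2 * Real.pi / 5) = Real.cos (Real.pi / 10) := by
    rw [← Real.sin_pi_div_two_sub]
    ring_nf
  rw [Complex.add_conj, hre, hG, hs]
  push_cast
  ring

/-- If the primitive `E` of `e` tends to `L` at a quadratic rate, then the integral over `[0, a]` of
`h · φ' · e (N φ)` is `h 0 · L / N` up to `O(N⁻²)`. -/
theorem exists_norm_integral_mul_comp_sub_le {E e : ℝ → ℂ} {L : ℂ} {K : ℝ}
    (hE : ∀ u, HasDerivAt E (e u) u) (he : Continuous e) (hE0 : E 0 = 0)
    (hK : ∀ u, 0 ≤ u → ‖L - E u‖ ≤ K / (1 + u ^ 2)) {a c : ℝ} (ha : 0 < a) (hc : 0 < c)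
    {φ ψ : ℝ → ℝ} {h h' : ℝ → ℂ} (hφ : ∀ z ∈ Set.Icc 0 a, HasDerivAt φ (ψ z) z)
    (hψ : ContinuousOn ψ (Set.Icc 0 a)) (hh : ∀ z ∈ Set.Icc 0 a, HasDerivAt h (h' z) z)
    (hh' : ContinuousOn h' (Set.Icc 0 a)) (hha : h a = 0) (hφ0 : φ 0 = 0)
    (hφc : ∀ z ∈ Set.Icc 0 a, c * z ≤ φ z) :
    ∃ C : ℝ, ∀ N : ℝ, 0 < N →
      ‖(∫ z in (0 : ℝ)..a, h z * (ψ z * e (N * φ z))) - h 0 * L / N‖ ≤ C / N ^ 2 := by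
  have hu : Set.uIcc 0 a = Set.Icc 0 a := Set.uIcc_of_le ha.le
  obtain ⟨M, hM⟩ := isCompact_Icc.exists_bound_of_continuousOn hh'
  have hM0 : 0 ≤ M := (norm_nonneg _).trans (hM 0 ⟨le_rfl, ha.le⟩)
  have hK0 : 0 ≤ K := by
    have := (norm_nonneg _).trans (hK 0 le_rfl)
    simpa using this
  refine ⟨M * K / c * (Real.pi / 2), fun N hN => ?_⟩
  have hφcont : ContinuousOn φ (Set.Icc 0 a) := fun z hz => (hφ z hz).continuousAt.continuousWithinAt
  have hN' : (N : ℂ) ≠ 0 := by exact_mod_cast hN.ne'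
  have hv : ∀ z ∈ Set.uIcc 0 a, HasDerivAt (fun z => (E (N * φ z) - L) / N)
      (ψ z * e (N * φ z)) z := by
    intro z hz
    rw [hu] at hz
    have h1 := (hE (N * φ z)).scomp z ((hφ z hz).const_mul N)
    have h2 := (h1.sub_const L).div_const (N : ℂ)
    convert! h2 using 1
    rw [Complex.real_smul]
    push_cast
    field_simp
  have hparts := intervalIntegral.integral_mul_deriv_eq_deriv_mul (a := 0) (b := a)
    (u := h) (u' := h') (fun z hz => hh z (hu ▸ hz)) hv
    (ContinuousOn.intervalIntegrable (by rwa [hu]))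
    (ContinuousOn.intervalIntegrable (by
      rw [hu]
      exact (Complex.continuous_ofReal.comp_continuousOn hψ).mul
        (he.comp_continuousOn (hφcont.const_mul N))))
  have hrem : (∫ z in (0 : ℝ)..a, h z * (ψ z * e (N * φ z))) - h 0 * L / N =
      -∫ z in (0 : ℝ)..a, h' z * ((E (N * φ z) - L) / N) := by
    rw [hparts, hha, hφ0, mul_zero, hE0]
    ring
  rw [hrem, norm_neg]
  have hNc : N * c ≠ 0 := by positivity
  calc _ ≤ ∫ z in (0 : ℝ)..a, M * K / N * (1 + (N * c * z) ^ 2)⁻¹ := by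
        refine intervalIntegral.norm_integral_le_of_norm_le ha.le
          (Filter.Eventually.of_forall fun z hz => ?_)
          (Continuous.intervalIntegrable ?_ _ _)
        · have hz' : z ∈ Set.Icc 0 a := ⟨hz.1.le, hz.2⟩
          have hcz : 0 ≤ N * (c * z) := mul_nonneg hN.le (mul_nonneg hc.le hz'.1)
          have h1 : N * (c * z) ≤ N * φ z := mul_le_mul_of_nonneg_left (hφc z hz') hN.le
          have h2 : ‖E (N * φ z) - L‖ ≤ K / (1 + (N * (c * z)) ^ 2) := by
            rw [norm_sub_rev]
            refine (hK _ (hcz.trans h1)).trans ?_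
            gcongr
          rw [norm_mul, norm_div, Complex.norm_real, Real.norm_of_nonneg hN.le]
          calc _ ≤ M * (K / (1 + (N * (c * z)) ^ 2) / N) := by
                gcongr
                exact hM z hz'
            _ = _ := by
                rw [mul_assoc N c z]
                field_simp
        · exact continuous_const.mul (Continuous.inv₀ (by fun_prop) fun z => by positivity)
    _ = M * K / N * ((N * c)⁻¹ * Real.arctan (N * c * a)) := by
        rw [intervalIntegral.integral_const_mul,
          intervalIntegral.integral_comp_mul_left (fun x => (1 + x ^ 2)⁻¹) hNc,
          integral_inv_one_add_sq]
        simp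
    _ ≤ M * K / N * ((N * c)⁻¹ * (Real.pi / 2)) := by
        gcongr
        exact (Real.arctan_lt_pi_div_two _).le
    _ = _ := by
        field_simp

theorem exists_norm_integral_exp_pow_five_sub_le {a c : ℝ} (ha : 0 < a) (hc : 0 < c)
    {φ ψ : ℝ → ℝ} {h h' : ℝ → ℂ} (hφ : ∀ z ∈ Set.Icc (-a) a, HasDerivAt φ (ψ z) z)
    (hψ : ContinuousOn ψ (Set.Icc (-a) a)) (hh : ∀ z ∈ Set.Icc (-a) a, HasDerivAt h (h' z) z)
    (hh' : ContinuousOn h' (Set.Icc (-a) a)) (hha : h a = 0) (hhna : h (-a) = 0) (hφ0 : φ 0 = 0)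
    (hφpos : ∀ z ∈ Set.Icc 0 a, c * z ≤ φ z) (hφneg : ∀ z ∈ Set.Icc (-a) 0, φ z ≤ c * z) :
    ∃ C : ℝ, ∀ N : ℝ, 0 < N →
      ‖(∫ z in (-a)..a, h z * (ψ z * Complex.exp (Complex.I * (N * φ z : ℝ) ^ 5))) -
        h 0 * (quinticFresnel + starRingEnd ℂ quinticFresnel) / N‖ ≤ C / N ^ 2 := by
  obtain ⟨K, hK⟩ := exists_norm_quinticFresnel_sub_integral_le
  set E : ℝ → ℂ := fun u => ∫ s in (0 : ℝ)..u, Complex.exp (Complex.I * s ^ 5) with hEdef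
  have hecont : Continuous fun s : ℝ => Complex.exp (Complex.I * s ^ 5) := by fun_prop
  have hE : ∀ u : ℝ, HasDerivAt E (Complex.exp (Complex.I * u ^ 5)) u := fun u =>
    hecont.integral_hasStrictDerivAt 0 u |>.hasDerivAt
  have hE0 : E 0 = 0 := by simp [hEdef]
  have hEc : ∀ u : ℝ, HasDerivAt (fun u => starRingEnd ℂ (E u))
      (starRingEnd ℂ (Complex.exp (Complex.I * u ^ 5))) u := fun u =>
    Complex.conjCLE.toContinuousLinearMap.hasFDerivAt.comp_hasDerivAt u (hE u)
  have hsub : Set.Icc 0 a ⊆ Set.Icc (-a) a := Set.Icc_subset_Icc_left (by linarith)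
  have hneg : ∀ z ∈ Set.Icc 0 a, -z ∈ Set.Icc (-a) a := fun z hz =>
    ⟨by linarith [hz.2], by linarith [hz.1]⟩
  have hnegc : ContinuousOn (fun z : ℝ => -z) (Set.Icc 0 a) := continuous_neg.continuousOn
  obtain ⟨C₁, hC₁⟩ := exists_norm_integral_mul_comp_sub_le hE hecont hE0 hK ha hc
    (fun z hz => hφ z (hsub hz)) (hψ.mono hsub) (fun z hz => hh z (hsub hz)) (hh'.mono hsub)
    hha hφ0 hφpos
  obtain ⟨C₂, hC₂⟩ := exists_norm_integral_mul_comp_sub_le (K := K)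
    (L := starRingEnd ℂ quinticFresnel) (φ := fun z => -φ (-z)) (ψ := fun z => ψ (-z))
    (h := fun z => h (-z)) (h' := fun z => -h' (-z)) hEc
    (Complex.continuous_conj.comp hecont) (by simp [hE0])
    (fun u hu => by
      rw [← map_sub, Complex.norm_conj]
      exact hK u hu) ha hc
    (fun z hz => by
      have := ((hφ (-z) (hneg z hz)).scomp z (hasDerivAt_neg z)).neg
      simpa [Function.comp_def] using! this)
    (hψ.comp hnegc hneg)
    (fun z hz => by
      have := (hh (-z) (hneg z hz)).scomp z (hasDerivAt_neg z)
      simpa [Function.comp_def] using! this)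
    (hh'.comp hnegc hneg).neg hhna (by simp [hφ0])
    (fun z hz => by
      have := hφneg (-z) ⟨by linarith [hz.2], by linarith [hz.1]⟩
      linarith)
  refine ⟨C₁ + C₂, fun N hN => ?_⟩
  have hφcont : ContinuousOn φ (Set.Icc (-a) a) :=
    fun z hz => (hφ z hz).continuousAt.continuousWithinAt
  have hhcont : ContinuousOn h (Set.Icc (-a) a) :=
    fun z hz => (hh z hz).continuousAt.continuousWithinAt
  have hF : ContinuousOn
      (fun z => h z * (ψ z * Complex.exp (Complex.I * (N * φ z : ℝ) ^ 5))) (Set.Icc (-a) a) :=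
    hhcont.mul ((Complex.continuous_ofReal.comp_continuousOn hψ).mul
      (hecont.comp_continuousOn (hφcont.const_mul N)))
  have hsplit := intervalIntegral.integral_add_adjacent_intervals (μ := volume) (a := -a) (b := 0)
    (c := a)
    (f := fun z => h z * (ψ z * Complex.exp (Complex.I * (N * φ z : ℝ) ^ 5)))
    (ContinuousOn.intervalIntegrable (by
      rw [Set.uIcc_of_le (by linarith)]
      exact hF.mono (Set.Icc_subset_Icc_right ha.le)))
    (ContinuousOn.intervalIntegrable (by
      rw [Set.uIcc_of_le ha.le]
      exact hF.mono hsub))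
  have hflip := intervalIntegral.integral_comp_neg (a := 0) (b := a)
    (fun z => h z * (ψ z * Complex.exp (Complex.I * (N * φ z : ℝ) ^ 5)))
  rw [neg_zero] at hflip
  have hconj : ∀ z : ℝ, starRingEnd ℂ (Complex.exp (Complex.I * ((N * -φ (-z) : ℝ) : ℂ) ^ 5)) =
      Complex.exp (Complex.I * ((N * φ (-z) : ℝ) : ℂ) ^ 5) := by
    intro z
    rw [← Complex.exp_conj, map_mul, map_pow, Complex.conj_I, Complex.conj_ofReal]
    congr 1
    push_cast
    ring
  have hb := hC₂ N hN
  simp only [hconj, neg_zero] at hb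
  rw [hflip] at hb
  rw [← hsplit]
  calc _ = ‖((∫ z in (-a)..0, h z * (ψ z * Complex.exp (Complex.I * (N * φ z : ℝ) ^ 5))) -
          h 0 * starRingEnd ℂ quinticFresnel / N) +
        ((∫ z in (0 : ℝ)..a, h z * (ψ z * Complex.exp (Complex.I * (N * φ z : ℝ) ^ 5))) -
          h 0 * quinticFresnel / N)‖ := by
        congr 1
        ring
    _ ≤ C₂ / N ^ 2 + C₁ / N ^ 2 := (norm_add_le _ _).trans (add_le_add hb (hC₁ N hN))
    _ = _ := by ring

theorem contDiff_integral_mul_comp_mul (n : ℕ) : ∀ {p k : ℝ → ℝ}, Continuous p →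
    ContDiff ℝ n k → ContDiff ℝ n fun z => ∫ t in (0 : ℝ)..1, p t * k (t * z) := by
  induction n with
  | zero =>
    intro p k hp hk
    have hk' := hk.continuous
    exact contDiff_zero.2
      (intervalIntegral.continuous_parametric_intervalIntegral_of_continuous' (by fun_prop) 0 1)
  | succ n ih =>
    intro p k hp hk
    have hk1 : ContDiff ℝ n (deriv k) := (contDiff_succ_iff_deriv.1 (by exact_mod_cast hk)).2.2
    have hkd : Differentiable ℝ k := hk.differentiable (by simp)
    have hkc := hk.continuous
    have hk1c := hk1.continuous
    have hder : ∀ z, HasDerivAt (fun z => ∫ t in (0 : ℝ)..1, p t * k (t * z))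
        (∫ t in (0 : ℝ)..1, p t * t * deriv k (t * z)) z := by
      intro z
      have hcont : Continuous fun q : ℝ × ℝ => p q.2 * q.2 * deriv k (q.2 * q.1) := by fun_prop
      obtain ⟨M, hM⟩ := ((isCompact_closedBall z 1).prod (isCompact_Icc (a := (0 : ℝ)) (b := 1)))
        |>.exists_bound_of_continuousOn hcont.continuousOn
      refine (intervalIntegral.hasDerivAt_integral_of_dominated_loc_of_deriv_le
        (F := fun z t => p t * k (t * z)) (F' := fun z t => p t * t * deriv k (t * z))
        (bound := fun _ => M) (Metric.closedBall_mem_nhds z one_pos)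
        (Filter.Eventually.of_forall fun x => Continuous.aestronglyMeasurable (by fun_prop))
        (Continuous.intervalIntegrable (by fun_prop) _ _)
        (Continuous.aestronglyMeasurable (by fun_prop))
        (Filter.Eventually.of_forall fun t ht x hx => ?_)
        intervalIntegrable_const
        (Filter.Eventually.of_forall fun t ht x hx => ?_)).2
      · rw [Set.uIoc_of_le zero_le_one] at ht
        exact hM (x, t) ⟨hx, ht.1.le, ht.2⟩
      · have h1 : HasDerivAt (fun x => t * x) t x := by
          simpa using (hasDerivAt_id x).const_mul t
        have h2 := ((hkd (t * x)).hasDerivAt.comp x h1).const_mul (p t)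
        convert! h2 using 1
        ring
    have hc : ContDiff ℝ ((n : WithTop ℕ∞) + 1) fun z => ∫ t in (0 : ℝ)..1, p t * k (t * z) := by
      refine contDiff_succ_iff_deriv.2 ⟨fun z => (hder z).differentiableAt, by simp, ?_⟩
      rw [funext fun z => (hder z).deriv]
      exact ih (hp.mul continuous_id) hk1
    exact_mod_cast hc

theorem exists_contDiff_eq_add_pow_five_mul {lam : ℝ → ℝ} (hlam : ContDiff ℝ (⊤ : ℕ∞) lam)
    (h1 : deriv lam 0 = 0) (h2 : iteratedDeriv 2 lam 0 = 0)
    (h3 : iteratedDeriv 3 lam 0 = 0) (h4 : iteratedDeriv 4 lam 0 = 0) :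
    ∃ g : ℝ → ℝ, ContDiff ℝ 2 g ∧ g 0 = iteratedDeriv 5 lam 0 / 120 ∧
      ∀ z, lam z = lam 0 + z ^ 5 * g z := by
  have hk : ContDiff ℝ (2 : ℕ) (iteratedDeriv 5 lam) :=
    by
    rw [iteratedDeriv_eq_iterate]
    exact (contDiff_infty.1 hlam (2 + 5)).iterate_deriv' 2 5
  refine ⟨fun z => ∫ t in (0 : ℝ)..1, (1 - t) ^ 4 / 24 * iteratedDeriv 5 lam (t * z),
    contDiff_integral_mul_comp_mul 2 (by fun_prop) hk, ?_, fun z => ?_⟩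
  · simp only [mul_zero, intervalIntegral.integral_mul_const, intervalIntegral.integral_div]
    rw [intervalIntegral.integral_comp_sub_left (fun t : ℝ => t ^ 4) 1, integral_pow]
    norm_num
    ring
  · rcases eq_or_ne z 0 with rfl | hz
    · simp
    have hud := uniqueDiffOn_uIcc hz.symm
    have hcd : ∀ (n : ℕ) (t : ℝ), t ∈ Set.uIcc 0 z →
        iteratedDerivWithin n lam (Set.uIcc 0 z) t = iteratedDeriv n lam t := fun n t ht =>
      iteratedDerivWithin_eq_iteratedDeriv hud
        (contDiff_infty.1 hlam n).contDiffAt ht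
    have hT := taylor_integral_remainder (f := lam) (x := z) (x₀ := 0) (n := 4)
      (contDiff_infty.1 hlam _).contDiffOn
    have heval : taylorWithinEval lam 4 (Set.uIcc 0 z) 0 z = lam 0 := by
      rw [taylor_within_apply]
      simp [Finset.sum_range_succ, hcd _ 0 Set.left_mem_uIcc, h1, h2, h3, h4]
    rw [heval, intervalIntegral.integral_congr
      (g := fun t => (z - t) ^ 4 / 24 * iteratedDeriv 5 lam t)
      (fun t ht => by simp [hcd _ t ht, Nat.factorial])] at hT
    have hs := intervalIntegral.mul_integral_comp_mul_left (a := 0) (b := 1)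
      (f := fun t => (z - t) ^ 4 / 24 * iteratedDeriv 5 lam t) z
    rw [mul_zero, mul_one, ← hT] at hs
    have hpow : (∫ t in (0 : ℝ)..1, (z - z * t) ^ 4 / 24 * iteratedDeriv 5 lam (z * t)) =
        z ^ 4 * ∫ t in (0 : ℝ)..1, (1 - t) ^ 4 / 24 * iteratedDeriv 5 lam (t * z) := by
      rw [← intervalIntegral.integral_const_mul]
      refine intervalIntegral.integral_congr fun t _ => ?_
      simp only [mul_comm z t]
      ring
    rw [hpow] at hs
    linear_combination -hs

/-- The phase is `lam 0 + φ⁵` near `0` for a coordinate `φ = z · g ^ (1/5)`. -/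
theorem exists_coordinate_pow_five {g : ℝ → ℝ} (hg : ContDiff ℝ 2 g) (hg0 : 0 < g 0) :
    ∃ δ > 0, ∃ c > 0, ∃ V : Set ℝ, IsOpen V ∧ Set.Icc (-δ) δ ⊆ V ∧ ∃ φ ψ : ℝ → ℝ,
      (∀ z ∈ V, HasDerivAt φ (ψ z) z) ∧ ContDiffOn ℝ 1 ψ V ∧ (∀ z ∈ V, ψ z ≠ 0) ∧
      φ 0 = 0 ∧ ψ 0 = g 0 ^ ((1 : ℝ) / 5) ∧ (∀ z ∈ V, φ z ^ 5 = z ^ 5 * g z) ∧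
      (∀ z ∈ V, 0 ≤ z → c * z ≤ φ z) ∧ ∀ z ∈ V, z ≤ 0 → φ z ≤ c * z := by
  set m : ℝ → ℝ := fun z => g z ^ ((1 : ℝ) / 5) with hm
  set φ : ℝ → ℝ := fun z => z * m z with hφ
  have hU : IsOpen {z | 0 < g z} := isOpen_lt continuous_const hg.continuous
  have hmU : ContDiffOn ℝ 2 m {z | 0 < g z} := fun z hz =>
    (hg.contDiffAt.rpow_const_of_ne (ne_of_gt hz)).contDiffWithinAt
  have hφU : ContDiffOn ℝ 2 φ {z | 0 < g z} := contDiffOn_id.mul hmU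
  have hψU : ContDiffOn ℝ 1 (deriv φ) {z | 0 < g z} :=
    hφU.deriv_of_isOpen hU (by norm_num)
  have hm0 : 0 < m 0 := Real.rpow_pos_of_pos hg0 _
  have hnhds : {z | 0 < g z} ∈ nhds (0 : ℝ) := hU.mem_nhds hg0
  have hψ0 : deriv φ 0 = m 0 := by
    have h1 := (hmU.contDiffAt hnhds).differentiableAt (by norm_num)
    have h2 := ((hasDerivAt_id (0 : ℝ)).mul h1.hasDerivAt).deriv
    simpa using! h2
  have hev : ∀ᶠ z in nhds (0 : ℝ), 0 < g z ∧ deriv φ z ≠ 0 ∧ m 0 / 2 < m z := by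
    refine Filter.Eventually.and hnhds (Filter.Eventually.and ?_ ?_)
    · exact (hψU.continuousOn.continuousAt hnhds).eventually_ne (by rw [hψ0]; exact hm0.ne')
    · exact (hmU.continuousOn.continuousAt hnhds).eventually_const_lt (by linarith)
  obtain ⟨ε, hε, hball⟩ := Metric.eventually_nhds_iff_ball.1 hev
  refine ⟨ε / 2, by positivity, m 0 / 2, by positivity, Metric.ball 0 ε, Metric.isOpen_ball, ?_,
    φ, deriv φ, fun z hz => ?_, hψU.mono fun z hz => (hball z hz).1, fun z hz => (hball z hz).2.1,
    by simp [hφ], hψ0, fun z hz => ?_, fun z hz h0 => ?_, fun z hz h0 => ?_⟩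
  · intro z hz
    rw [Metric.mem_ball, dist_zero_right, Real.norm_eq_abs, abs_lt]
    constructor <;> linarith [hz.1, hz.2]
  · exact ((hφU.contDiffAt (hU.mem_nhds (hball z hz).1)).differentiableAt (by norm_num)).hasDerivAt
  · rw [hφ, hm, mul_pow, ← Real.rpow_natCast (g z ^ _), ← Real.rpow_mul (hball z hz).1.le]
    norm_num
  · rw [hφ, mul_comm]
    exact mul_le_mul_of_nonneg_left (hball z hz).2.2.le h0
  · rw [hφ, mul_comm (m 0 / 2)]
    exact mul_le_mul_of_nonpos_left (hball z hz).2.2.le h0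

theorem stationary_phase_quintic_of_pos (lam : ℝ → ℝ) (hlam : ContDiff ℝ (⊤ : ℕ∞) lam)
    (h1 : deriv lam 0 = 0) (h2 : iteratedDeriv 2 lam 0 = 0)
    (h3 : iteratedDeriv 3 lam 0 = 0) (h4 : iteratedDeriv 4 lam 0 = 0)
    (h5 : 0 < iteratedDeriv 5 lam 0) :
    ∃ δ > 0, ∀ f : ℝ → ℂ, ContDiff ℝ 1 f → Function.support f ⊆ Set.Ioo (-δ) δ →
      ∃ C > 0, ∀ ω : ℝ, 0 < ω →
        ‖(∫ z : ℝ, f z * Complex.exp (Complex.I * ω * lam z)) -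
            Complex.exp (Complex.I * (lam 0) * ω) *
              (((2 / 5 : ℝ) * Real.Gamma (1 / 5) * Real.sin (2 * Real.pi / 5) : ℝ) : ℂ) *
              (((120 / |iteratedDeriv 5 lam 0|) ^ ((1 : ℝ) / 5) : ℝ) : ℂ) * f 0 *
              ((ω ^ (-(1 / 5 : ℝ)) : ℝ) : ℂ)‖
          ≤ C * ω ^ (-(2 / 5 : ℝ)) := by
  obtain ⟨g, hg, hg0, hlg⟩ := exists_contDiff_eq_add_pow_five_mul hlam h1 h2 h3 h4
  obtain ⟨δ, hδ, c, hc, V, hV, hδV, φ, ψ, hφ, hψ, hψne, hφ0, hψ0, hφ5, hpos, hneg⟩ :=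
    exists_coordinate_pow_five hg (by rw [hg0]; positivity)
  refine ⟨δ, hδ, fun f hf hsupp => ?_⟩
  have hout : ∀ z, z ∉ Set.Ioo (-δ) δ → f z = 0 := fun z hz =>
    Function.notMem_support.1 fun h => hz (hsupp h)
  set h : ℝ → ℂ := fun z => f z * ((ψ z)⁻¹ : ℝ) with hdef
  have hh : ContDiffOn ℝ 1 h V := hf.contDiffOn.mul
    (Complex.ofRealCLM.contDiff.comp_contDiffOn (hψ.inv hψne))
  have hsub0 : Set.Icc 0 δ ⊆ Set.Icc (-δ) δ := Set.Icc_subset_Icc_left (by linarith)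
  have hsub1 : Set.Icc (-δ) 0 ⊆ Set.Icc (-δ) δ := Set.Icc_subset_Icc_right hδ.le
  obtain ⟨C, hC⟩ := exists_norm_integral_exp_pow_five_sub_le (h := h) (h' := deriv h) hδ hc
    (fun z hz => hφ z (hδV hz)) (hψ.continuousOn.mono hδV)
    (fun z hz => ((hh.contDiffAt (hV.mem_nhds (hδV hz))).differentiableAt one_ne_zero).hasDerivAt)
    ((hh.continuousOn_deriv_of_isOpen hV le_rfl).mono hδV)
    (by simp [hdef, hout δ (by simp)]) (by simp [hdef, hout (-δ) (by simp)]) hφ0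
    (fun z hz => hpos z (hδV (hsub0 hz)) hz.1) (fun z hz => hneg z (hδV (hsub1 hz)) hz.2)
  refine ⟨|C| + 1, by positivity, fun ω hω => ?_⟩
  set N : ℝ := ω ^ ((1 : ℝ) / 5) with hN
  have hN0 : 0 < N := Real.rpow_pos_of_pos hω _
  have hN5 : N ^ 5 = ω := by
    rw [hN, ← Real.rpow_natCast, ← Real.rpow_mul hω.le]
    norm_num
  have hN1 : ω ^ (-(1 / 5 : ℝ)) = N⁻¹ := Real.rpow_neg hω.le _
  have hN2 : ω ^ (-(2 / 5 : ℝ)) = (N ^ 2)⁻¹ := by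
    rw [Real.rpow_neg hω.le, hN, ← Real.rpow_natCast (ω ^ _), ← Real.rpow_mul hω.le]
    norm_num
  have hψ0' : (120 / |iteratedDeriv 5 lam 0|) ^ ((1 : ℝ) / 5) = (ψ 0)⁻¹ := by
    rw [hψ0, hg0, abs_of_pos h5, ← Real.inv_rpow (by positivity), inv_div]
  have hint : (∫ z : ℝ, f z * Complex.exp (Complex.I * ω * lam z)) =
      Complex.exp (Complex.I * (lam 0) * ω) *
        ∫ z in (-δ)..δ, h z * (ψ z * Complex.exp (Complex.I * (N * φ z : ℝ) ^ 5)) := by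
    rw [← intervalIntegral.integral_eq_integral_of_support_subset (a := -δ) (b := δ),
      ← intervalIntegral.integral_const_mul]
    · refine intervalIntegral.integral_congr fun z hz => ?_
      rw [Set.uIcc_of_le (by linarith)] at hz
      have hψz : (ψ z : ℂ) ≠ 0 := Complex.ofReal_ne_zero.2 (hψne z (hδV hz))
      have hexp : Complex.exp (Complex.I * ω * lam z) = Complex.exp (Complex.I * (lam 0) * ω) *
          Complex.exp (Complex.I * (N * φ z : ℝ) ^ 5) := by
        rw [← Complex.exp_add, ← Complex.ofReal_pow, mul_pow, hN5, hφ5 z (hδV hz), hlg z]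
        congr 1
        push_cast
        ring
      simp only [hdef, hexp, Complex.ofReal_inv]
      field_simp
    · intro z hz
      exact Set.Ioo_subset_Ioc_self (hsupp (left_ne_zero_of_mul hz))
  rw [hint, hN1, hN2, hψ0', ← quinticFresnel_add_conj]
  have hphase : ‖Complex.exp (Complex.I * (lam 0) * ω)‖ = 1 := by
    have := Complex.norm_exp_ofReal_mul_I (lam 0 * ω)
    rwa [show ((lam 0 * ω : ℝ) : ℂ) * Complex.I = Complex.I * (lam 0) * ω by
      push_cast
      ring] at this
  calc _ = ‖Complex.exp (Complex.I * (lam 0) * ω) *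
        ((∫ z in (-δ)..δ, h z * (ψ z * Complex.exp (Complex.I * (N * φ z : ℝ) ^ 5))) -
          h 0 * (quinticFresnel + starRingEnd ℂ quinticFresnel) / N)‖ := by
        congr 1
        simp only [hdef]
        push_cast
        ring
    _ ≤ C / N ^ 2 := by
        rw [norm_mul, hphase, one_mul]
        exact hC N hN0
    _ ≤ (|C| + 1) * (N ^ 2)⁻¹ := by
        rw [div_eq_mul_inv]
        gcongr
        linarith [le_abs_self C]

theorem stationary_phase_quintic (lam : ℝ → ℝ) (hlam : ContDiff ℝ (⊤ : ℕ∞) lam)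
    (h1 : deriv lam 0 = 0) (h2 : iteratedDeriv 2 lam 0 = 0)
    (h3 : iteratedDeriv 3 lam 0 = 0) (h4 : iteratedDeriv 4 lam 0 = 0)
    (h5 : iteratedDeriv 5 lam 0 ≠ 0) :
    ∃ δ > 0, ∀ f : ℝ → ℂ, ContDiff ℝ (⊤ : ℕ∞) f → HasCompactSupport f →
      Function.support f ⊆ Set.Ioo (-δ) δ →
      ∃ C > 0, ∃ ω₀ > 0, ∀ ω : ℝ, ω₀ ≤ ω →
        ‖(∫ z : ℝ, f z * Complex.exp (Complex.I * ω * lam z)) -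
            Complex.exp (Complex.I * (lam 0) * ω) *
              (((2 / 5 : ℝ) * Real.Gamma (1 / 5) * Real.sin (2 * Real.pi / 5) : ℝ) : ℂ) *
              (((120 / |iteratedDeriv 5 lam 0|) ^ ((1 : ℝ) / 5) : ℝ) : ℂ) * f 0 *
              ((ω ^ (-(1 / 5 : ℝ)) : ℝ) : ℂ)‖
          ≤ C * ω ^ (-(2 / 5 : ℝ)) := by
  rcases h5.lt_or_gt with h5 | h5
  · have hit : ∀ n, iteratedDeriv n (fun z => lam (-z)) 0 = (-1) ^ n * iteratedDeriv n lam 0 := by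
      intro n
      simp [iteratedDeriv_comp_neg]
    obtain ⟨δ, hδ, H⟩ := stationary_phase_quintic_of_pos (fun z => lam (-z))
      (hlam.comp contDiff_neg) (by simpa [h1] using hit 1) (by simp [hit, h2]) (by simp [hit, h3])
      (by simp [hit, h4]) (by rw [hit]; linarith)
    refine ⟨δ, hδ, fun f hf _ hsupp => ?_⟩
    obtain ⟨C, hC, hCω⟩ := H (fun z => f (-z)) ((contDiff_infty.1 hf 1).comp contDiff_neg)
      fun z hz => by
        have := hsupp (show -z ∈ Function.support f from hz)
        exact ⟨by linarith [this.2], by linarith [this.1]⟩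
    refine ⟨C, hC, 1, one_pos, fun ω hω => ?_⟩
    have hb := hCω ω (by linarith)
    rw [integral_neg_eq_self (fun z => f z * Complex.exp (Complex.I * ω * lam z)) volume] at hb
    simpa [hit] using hb
  · obtain ⟨δ, hδ, H⟩ := stationary_phase_quintic_of_pos lam hlam h1 h2 h3 h4 h5
    refine ⟨δ, hδ, fun f hf _ hsupp => ?_⟩
    obtain ⟨C, hC, hCω⟩ := H f (contDiff_infty.1 hf 1) hsupp
    exact ⟨C, hC, 1, one_pos, fun ω hω => hCω ω (by linarith)⟩

end
end
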